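/- arXiv:0709.2821 — 3 statements merged into one kernel-verified Lean document; each statement's English description precedes it below -/
import Mathlib

section
/- Let N ≥ 1 and m ≥ 1 be integers and let g : ℝ → ℝ be convex with g(s) ≥ 0 for all s ∈ ℝ and g(s) > 0 for all s < 0. Suppose v : ℝ^N → ℝ is C^{2m}, v together with all its partial derivatives of order ≤ 2m is bounded on ℝ^N, and (−Δ)^m v(x) = g(v(x)) for all x ∈ ℝ^N. Then v(x) ≥ 0 for all x ∈ ℝ^N. -/
noncomputable def lap {N : ℕ} (f : EuclideanSpace ℝ (Fin N) → ℝ)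
    (x : EuclideanSpace ℝ (Fin N)) : ℝ :=
  ∑ i : Fin N, iteratedDeriv 2 (fun t : ℝ => f (x + t • EuclideanSpace.single i (1 : ℝ))) 0

noncomputable def polyLap {N : ℕ} (m : ℕ) (f : EuclideanSpace ℝ (Fin N) → ℝ)
    (x : EuclideanSpace ℝ (Fin N)) : ℝ :=
  (-1 : ℝ) ^ m * (lap^[m] f x)

open MeasureTheory Set Filter Topology
open scoped RealInnerProductSpace

section BoundedSmooth

variable {E : Type*} [NormedAddCommGroup E] [NormedSpace ℝ E]

/-- `f` is of class `C^n`, and its derivatives of order at most `n` are bounded. -/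
def BddSmooth (n : ℕ) (f : E → ℝ) : Prop :=
  ContDiff ℝ n f ∧ ∀ j ≤ n, ∃ C : ℝ, ∀ x, ‖iteratedFDeriv ℝ j f x‖ ≤ C

namespace BddSmooth

variable {n k : ℕ} {f : E → ℝ}

lemma mono (hf : BddSmooth n f) (h : k ≤ n) : BddSmooth k f :=
  ⟨hf.1.of_le (by exact_mod_cast h), fun j hj => hf.2 j (hj.trans h)⟩

lemma exists_abs_le (hf : BddSmooth n f) : ∃ C : ℝ, ∀ x, |f x| ≤ C := by
  obtain ⟨C, hC⟩ := hf.2 0 (Nat.zero_le _)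
  exact ⟨C, fun x => by simpa using hC x⟩

lemma exists_norm_fderiv_le (hf : BddSmooth (n + 1) f) : ∃ C : ℝ, ∀ x, ‖fderiv ℝ f x‖ ≤ C := by
  obtain ⟨C, hC⟩ := hf.2 1 (by omega)
  exact ⟨C, fun x => by
    have h := hC x
    rwa [← norm_iteratedFDeriv_fderiv, norm_iteratedFDeriv_zero] at h⟩

lemma differentiable (hf : BddSmooth (n + 1) f) : Differentiable ℝ f :=
  hf.1.differentiable (by simp)

lemma fderiv_apply (hf : BddSmooth (n + 1) f) (e : E) :
    BddSmooth n (fun x => fderiv ℝ f x e) := by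
  have hd : ContDiff ℝ n (fderiv ℝ f) := hf.1.fderiv_right (by norm_cast)
  refine ⟨hd.clm_apply contDiff_const, fun j hj => ?_⟩
  obtain ⟨C, hC⟩ := hf.2 (j + 1) (by omega)
  refine ⟨‖ContinuousLinearMap.apply ℝ ℝ e‖ * C, fun x => ?_⟩
  have h := (ContinuousLinearMap.apply ℝ ℝ e).norm_iteratedFDeriv_comp_left
    (hd.contDiffAt (x := x)) (n := j) (by exact_mod_cast hj)
  rw [norm_iteratedFDeriv_fderiv] at h
  exact h.trans (mul_le_mul_of_nonneg_left (hC x) (norm_nonneg _))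

lemma sum {ι : Type*} (s : Finset ι) {F : ι → E → ℝ} (hF : ∀ i, BddSmooth n (F i)) :
    BddSmooth n (fun x => ∑ i ∈ s, F i x) := by
  refine ⟨ContDiff.sum fun i _ => (hF i).1, fun j hj => ?_⟩
  choose C hC using fun i => (hF i).2 j hj
  refine ⟨∑ i ∈ s, C i, fun x => ?_⟩
  rw [iteratedFDeriv_fun_sum_apply
    fun i _ => ((hF i).1.of_le (by exact_mod_cast hj)).contDiffAt]
  exact norm_sum_le_of_le _ fun i _ => hC i x

end BddSmooth

end BoundedSmooth

section Laplacian

variable {N : ℕ} {f : EuclideanSpace ℝ (Fin N) → ℝ}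

lemma lap_eq_sum_fderiv (hf : ContDiff ℝ 2 f) :
    lap f = fun x => ∑ i : Fin N, fderiv ℝ (fun y => fderiv ℝ f y (EuclideanSpace.single i 1)) x
      (EuclideanSpace.single i 1) := by
  funext x
  refine Finset.sum_congr rfl fun i _ => ?_
  set e : EuclideanSpace ℝ (Fin N) := EuclideanSpace.single i 1
  have hline (t : ℝ) : HasDerivAt (fun t : ℝ => x + t • e) e t := by
    simpa using ((hasDerivAt_id t).smul_const e).const_add x
  have hd : deriv (fun t : ℝ => f (x + t • e)) = fun t => fderiv ℝ f (x + t • e) e := by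
    funext t
    exact ((hf.differentiable (by norm_num) _).hasFDerivAt.comp_hasDerivAt t (hline t)).deriv
  have hf' : Differentiable ℝ (fun y => fderiv ℝ f y e) :=
    ((hf.fderiv_right (m := 1) (by norm_num)).clm_apply contDiff_const).differentiable
      (by norm_num)
  rw [iteratedDeriv_succ, iteratedDeriv_one, hd]
  simpa [Function.comp_def] using ((hf' _).hasFDerivAt.comp_hasDerivAt 0 (hline 0)).deriv

lemma BddSmooth.lap {n : ℕ} (hf : BddSmooth (n + 2) f) : BddSmooth n (lap f) := by
  rw [lap_eq_sum_fderiv (hf.1.of_le (by norm_cast; omega))]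
  exact BddSmooth.sum _ fun i => (hf.fderiv_apply _).fderiv_apply _

lemma BddSmooth.iterate_lap {m : ℕ} (hf : BddSmooth (2 * m) f) (k : ℕ) (hk : k ≤ m) :
    BddSmooth (2 * (m - k)) (_root_.lap^[k] f) := by
  induction k with
  | zero => simpa using hf
  | succ k ih =>
    rw [Function.iterate_succ_apply']
    exact ((ih (by omega)).mono (by omega)).lap

end Laplacian

section Gaussian

variable {V : Type*} [NormedAddCommGroup V] [InnerProductSpace ℝ V] [FiniteDimensional ℝ V]
  [MeasurableSpace V] [BorelSpace V]

lemma integrable_exp_neg_mul_sq_norm {b : ℝ} (hb : 0 < b) :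
    Integrable (fun z : V => Real.exp (-b * ‖z‖ ^ 2)) := by
  have h := (GaussianFourier.integrable_cexp_neg_mul_sq_norm_add (V := V) (b := b)
    (by simpa using hb) 0 0).norm
  refine h.congr (Eventually.of_forall fun z => ?_)
  simp only [Complex.norm_exp, zero_mul, add_zero]
  norm_cast

variable (V) in
/-- The standard Gaussian measure, given by its density. -/
noncomputable def gaussianTilt : Measure V :=
  (volume : Measure V).tilted fun z => -(1 / 2) * ‖z‖ ^ 2

lemma integrable_exp_half_sq_norm :
    Integrable (fun z : V => Real.exp (-(1 / 2) * ‖z‖ ^ 2)) :=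
  integrable_exp_neg_mul_sq_norm (by norm_num)

instance : IsProbabilityMeasure (gaussianTilt V) :=
  isProbabilityMeasure_tilted integrable_exp_half_sq_norm

lemma integrable_norm_gaussianTilt : Integrable (fun z : V => ‖z‖) (gaussianTilt V) := by
  rw [gaussianTilt, integrable_tilted_iff integrable_exp_half_sq_norm]
  refine (integrable_exp_neg_mul_sq_norm (V := V) (b := 1 / 4) (by norm_num)).mono'
    (by fun_prop) (Eventually.of_forall fun z => ?_)
  have h1 : ‖z‖ ≤ Real.exp (1 / 4 * ‖z‖ ^ 2) := by
    nlinarith [Real.add_one_le_exp (1 / 4 * ‖z‖ ^ 2), sq_nonneg (‖z‖ / 2 - 1)]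
  have h2 : Real.exp (-(1 / 4) * ‖z‖ ^ 2) =
      Real.exp (-(1 / 2) * ‖z‖ ^ 2) * Real.exp (1 / 4 * ‖z‖ ^ 2) := by
    rw [← Real.exp_add]; ring_nf
  rw [h2, norm_smul, norm_norm, Real.norm_eq_abs, Real.abs_exp]
  gcongr

lemma integrable_gaussianTilt_of_abs_le {F : V → ℝ} (hF : Continuous F) {C : ℝ}
    (hC : ∀ z, |F z| ≤ C) : Integrable F (gaussianTilt V) :=
  (integrable_const C).mono' hF.aestronglyMeasurable (Eventually.of_forall hC)

lemma integrable_inner_mul_gaussianTilt {F : V → ℝ} (hF : Continuous F) {C : ℝ}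
    (hC : ∀ z, |F z| ≤ C) (e : V) : Integrable (fun z => ⟪z, e⟫ * F z) (gaussianTilt V) := by
  refine ((integrable_norm_gaussianTilt (V := V)).mul_const (‖e‖ * C)).mono'
    (by fun_prop) (Eventually.of_forall fun z => ?_)
  rw [norm_mul, ← mul_assoc]
  exact mul_le_mul (norm_inner_le_norm z e) (hC z) (norm_nonneg _) (by positivity)

/-- Gaussian integration by parts (Stein's lemma). -/
lemma integral_inner_mul_gaussianTilt {F : V → ℝ} (hF : ContDiff ℝ 1 F) {C D : ℝ}
    (hC : ∀ z, |F z| ≤ C) (e : V) (hD : ∀ z, |fderiv ℝ F z e| ≤ D) :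
    ∫ z, ⟪z, e⟫ * F z ∂gaussianTilt V = ∫ z, fderiv ℝ F z e ∂gaussianTilt V := by
  have hφ (z : V) : HasFDerivAt (fun z : V => Real.exp (-(1 / 2) * ‖z‖ ^ 2))
      (Real.exp (-(1 / 2) * ‖z‖ ^ 2) • (-(1 / 2 : ℝ)) • (2 : ℕ) • innerSL ℝ z) z :=
    (((hasStrictFDerivAt_norm_sq z).hasFDerivAt).const_mul _).exp
  have hφe (z : V) : fderiv ℝ (fun z : V => Real.exp (-(1 / 2) * ‖z‖ ^ 2)) z e =
      -(Real.exp (-(1 / 2) * ‖z‖ ^ 2) * ⟪z, e⟫) := by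
    rw [(hφ z).fderiv]
    simp
  have hF' : Continuous fun z => fderiv ℝ F z e :=
    (hF.continuous_fderiv (by norm_num)).clm_apply continuous_const
  have hi := (integrable_tilted_iff integrable_exp_half_sq_norm _).1
    (integrable_inner_mul_gaussianTilt hF.continuous hC e)
  have h := integral_mul_fderiv_eq_neg_fderiv_mul_of_integrable (μ := (volume : Measure V))
    (f := fun z : V => Real.exp (-(1 / 2) * ‖z‖ ^ 2)) (g := F) (v := e)
    (by
      simp only [hφe]
      exact hi.neg.congr (Eventually.of_forall fun z => by simp; ring))
    ((integrable_tilted_iff integrable_exp_half_sq_norm _).1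
      (integrable_gaussianTilt_of_abs_le hF' hD))
    ((integrable_tilted_iff integrable_exp_half_sq_norm _).1
      (integrable_gaussianTilt_of_abs_le hF.continuous hC))
    (fun z _ => (hφ z).differentiableAt) (fun z _ => hF.differentiable (by norm_num) z)
  simp only [hφe] at h
  simp only [gaussianTilt, integral_tilted, smul_eq_mul, div_mul_eq_mul_div, integral_div]
  rw [h, ← integral_neg]
  congr 2
  funext z
  ring

end Gaussian

section GaussianAverage

variable {N : ℕ}

/-- The average of `f` against a centred Gaussian at `x` of standard deviation `s`. -/
noncomputable def gaussianAverage (f : EuclideanSpace ℝ (Fin N) → ℝ)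
    (x : EuclideanSpace ℝ (Fin N)) (s : ℝ) : ℝ :=
  ∫ z, f (x + s • z) ∂gaussianTilt (EuclideanSpace ℝ (Fin N))

lemma abs_gaussianAverage_le {f : EuclideanSpace ℝ (Fin N) → ℝ} {C : ℝ} (hC : ∀ x, |f x| ≤ C)
    (x : EuclideanSpace ℝ (Fin N)) (s : ℝ) : |gaussianAverage f x s| ≤ C := by
  simpa [gaussianAverage] using norm_integral_le_of_norm_le_const (f := fun z => f (x + s • z))
    (μ := gaussianTilt (EuclideanSpace ℝ (Fin N))) (Eventually.of_forall fun z => hC (x + s • z))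

lemma gaussianAverage_zero (f : EuclideanSpace ℝ (Fin N) → ℝ) (x : EuclideanSpace ℝ (Fin N)) :
    gaussianAverage f x 0 = f x := by
  simp [gaussianAverage]

lemma integral_fderiv_apply_self {f : EuclideanSpace ℝ (Fin N) → ℝ} (hf : BddSmooth 2 f)
    (x : EuclideanSpace ℝ (Fin N)) (s : ℝ) :
    ∫ z, fderiv ℝ f (x + s • z) z ∂gaussianTilt (EuclideanSpace ℝ (Fin N)) =
      s * gaussianAverage (lap f) x s := by
  let e (i : Fin N) : EuclideanSpace ℝ (Fin N) := EuclideanSpace.single i 1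
  let G (i : Fin N) (y : EuclideanSpace ℝ (Fin N)) : ℝ := fderiv ℝ f y (e i)
  have hG (i : Fin N) : BddSmooth 1 (G i) := hf.fderiv_apply _
  have hH (i : Fin N) : BddSmooth 0 (fun y => fderiv ℝ (G i) y (e i)) := (hG i).fderiv_apply _
  have hexp (z : EuclideanSpace ℝ (Fin N)) :
      fderiv ℝ f (x + s • z) z = ∑ i, ⟪z, e i⟫ * G i (x + s • z) := by
    have hz : z = ∑ i, ⟪z, e i⟫ • e i := by
      ext j
      simp [e, EuclideanSpace.inner_single_right, Pi.single_apply]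
    refine (congrArg (fderiv ℝ f (x + s • z)) hz).trans ?_
    simp only [map_sum, map_smul, smul_eq_mul, G]
  have hGd (i : Fin N) (z : EuclideanSpace ℝ (Fin N)) :
      fderiv ℝ (fun z => G i (x + s • z)) z (e i) = s * fderiv ℝ (G i) (x + s • z) (e i) := by
    have h : HasFDerivAt (fun z : EuclideanSpace ℝ (Fin N) => x + s • z)
        (s • ContinuousLinearMap.id ℝ _) z := ((hasFDerivAt_id z).const_smul s).const_add x
    have h' := (((hG i).differentiable (x + s • z)).hasFDerivAt.comp z h).fderiv
    simp only [Function.comp_def] at h'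
    simp [h']
  have hcont (i : Fin N) : ContDiff ℝ 1 (fun z => G i (x + s • z)) :=
    (hG i).1.comp (by fun_prop)
  simp only [hexp]
  rw [integral_finsetSum _ fun i _ => ?_, gaussianAverage,
    lap_eq_sum_fderiv (by simpa using hf.1), integral_finsetSum _ fun i _ => ?_, Finset.mul_sum]
  · refine Finset.sum_congr rfl fun i _ => ?_
    obtain ⟨C, hC⟩ := (hG i).exists_abs_le
    obtain ⟨D, hD⟩ := (hH i).exists_abs_le
    rw [integral_inner_mul_gaussianTilt (hcont i) (fun z => hC _) (e i) (D := |s| * D)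
      (fun z => by rw [hGd, abs_mul]; gcongr; exact hD _)]
    simp only [hGd, integral_const_mul]
    rfl
  · obtain ⟨D, hD⟩ := (hH i).exists_abs_le
    exact integrable_gaussianTilt_of_abs_le
      ((hH i).1.continuous.comp (by fun_prop)) fun z => hD _
  · obtain ⟨C, hC⟩ := (hG i).exists_abs_le
    exact integrable_inner_mul_gaussianTilt (hcont i).continuous (fun z => hC _) _

/-- The heat equation for Gaussian averages, with time expressed by the standard deviation. -/
lemma hasDerivAt_gaussianAverage {f : EuclideanSpace ℝ (Fin N) → ℝ} (hf : BddSmooth 2 f)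
    (x : EuclideanSpace ℝ (Fin N)) (s : ℝ) :
    HasDerivAt (gaussianAverage f x) (s * gaussianAverage (lap f) x s) s := by
  obtain ⟨C, hC⟩ := hf.exists_abs_le
  obtain ⟨D, hD⟩ := hf.exists_norm_fderiv_le
  have hc := hf.1.continuous
  have hc' : Continuous (fderiv ℝ f) := hf.1.continuous_fderiv (by norm_num)
  rw [← integral_fderiv_apply_self hf]
  refine (hasDerivAt_integral_of_dominated_loc_of_deriv_le
    (F := fun s z => f (x + s • z)) (F' := fun s z => fderiv ℝ f (x + s • z) z)
    (bound := fun z => D * ‖z‖) univ_mem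
    (Eventually.of_forall fun s => Continuous.aestronglyMeasurable (by fun_prop))
    (integrable_gaussianTilt_of_abs_le (by fun_prop) fun z => hC _)
    (Continuous.aestronglyMeasurable (by fun_prop))
    (Eventually.of_forall fun z t _ => ?_)
    (integrable_norm_gaussianTilt.const_mul D)
    (Eventually.of_forall fun z t _ => ?_)).2
  · exact (ContinuousLinearMap.le_opNorm _ z).trans
      (mul_le_mul_of_nonneg_right (hD _) (norm_nonneg z))
  · have hline : HasDerivAt (fun t : ℝ => x + t • z) z t := by
      simpa using ((hasDerivAt_id t).smul_const z).const_add x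
    exact (hf.differentiable (x + t • z)).hasFDerivAt.comp_hasDerivAt t hline

lemma map_gaussianAverage_le {f : EuclideanSpace ℝ (Fin N) → ℝ} (hf : BddSmooth 0 f)
    {g : ℝ → ℝ} (hg : ConvexOn ℝ univ g) (x : EuclideanSpace ℝ (Fin N)) (s : ℝ) :
    g (gaussianAverage f x s) ≤ gaussianAverage (fun y => g (f y)) x s := by
  obtain ⟨C, hC⟩ := hf.exists_abs_le
  have hgc : Continuous g := continuousOn_univ.1 (hg.continuousOn isOpen_univ)
  have hfc := hf.1.continuous
  obtain ⟨D, hD⟩ := (isCompact_Icc (a := -C) (b := C)).exists_bound_of_continuousOn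
    hgc.continuousOn
  exact hg.map_integral_le hgc.continuousOn isClosed_univ (by simp)
    (integrable_gaussianTilt_of_abs_le (by fun_prop) fun z => hC _)
    (integrable_gaussianTilt_of_abs_le (by fun_prop) fun z => hD _ (abs_le.1 (hC _)))

end GaussianAverage

section OrdinaryDifferential

lemma not_bounded_of_mul_le_deriv {f f' : ℝ → ℝ} (hf : ∀ s, HasDerivAt f (f' s) s) {C c s₀ : ℝ}
    (hC : ∀ s, |f s| ≤ C) (hc : 0 < c) (hs₀ : 0 ≤ s₀) (h : ∀ s ≥ s₀, s * c ≤ f' s) : False := by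
  have hd (s : ℝ) : HasDerivAt (fun s => f s - c / 2 * s ^ 2) (f' s - s * c) s := by
    refine ((hf s).sub ((hasDerivAt_pow 2 s).const_mul (c / 2))).congr_deriv ?_
    simp
    ring
  have hmono : MonotoneOn (fun s => f s - c / 2 * s ^ 2) (Ici s₀) := by
    refine monotoneOn_of_deriv_nonneg (convex_Ici s₀)
      (fun s _ => (hd s).continuousAt.continuousWithinAt)
      (fun s _ => (hd s).differentiableAt.differentiableWithinAt) fun s hs => ?_
    rw [interior_Ici] at hs
    rw [(hd s).deriv]
    exact sub_nonneg.2 (h s (le_of_lt hs))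
  have hC0 : 0 ≤ C := (abs_nonneg _).trans (hC 0)
  obtain ⟨r, hr⟩ : ∃ r, r = 4 * C / c := ⟨_, rfl⟩
  have hr0 : 0 ≤ r := hr ▸ by positivity
  have hrc : c * r = 4 * C := by rw [hr]; field_simp
  have hle := hmono self_mem_Ici (show s₀ ≤ s₀ + 1 + r by linarith) (by linarith)
  have h1 := abs_le.1 (hC s₀)
  have h2 := abs_le.1 (hC (s₀ + 1 + r))
  have h3 : c * (1 + r) ≤ c * ((s₀ + 1 + r) ^ 2 - s₀ ^ 2) := by
    gcongr
    nlinarith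
  simp only at hle
  nlinarith

lemma antitoneOn_of_hasDerivAt_neg_mul {f f₁ : ℝ → ℝ}
    (hf : ∀ s, HasDerivAt f (-(s * f₁ s)) s) (h : ∀ s, 0 ≤ s → 0 ≤ f₁ s) :
    AntitoneOn f (Ici 0) := by
  refine antitoneOn_of_deriv_nonpos (convex_Ici 0)
    (fun s _ => (hf s).continuousAt.continuousWithinAt)
    (fun s _ => (hf s).differentiableAt.differentiableWithinAt) fun s hs => ?_
  rw [interior_Ici] at hs
  rw [(hf s).deriv]
  exact neg_nonpos.2 (mul_nonneg hs.le (h s hs.le))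

lemma nonneg_of_bounded_chain {m : ℕ} (hm : 0 < m) {W : ℕ → ℝ → ℝ}
    (hb : ∀ k ≤ m, ∃ C, ∀ s, |W k s| ≤ C)
    (hW : ∀ k < m, ∀ s, HasDerivAt (W k) (-(s * W (k + 1) s)) s)
    {g : ℝ → ℝ} (hgc : Continuous g) (hg_nonneg : ∀ s, 0 ≤ g s) (hg_pos : ∀ s < 0, 0 < g s)
    (hg : ∀ s, g (W 0 s) ≤ W m s) : 0 ≤ W 0 0 := by
  have hsign (k : ℕ) (hk : k < m) (s : ℝ) (hs : 0 ≤ s) : 0 ≤ W (k + 1) s := by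
    obtain ⟨d, hd⟩ : ∃ d, k + 1 + d = m := ⟨m - (k + 1), by omega⟩
    induction d generalizing k s with
    | zero =>
      obtain rfl : k + 1 = m := by omega
      exact (hg_nonneg _).trans (hg s)
    | succ d ih =>
      have hanti := antitoneOn_of_hasDerivAt_neg_mul (hW (k + 1) (by omega))
        fun s hs => ih (k + 1) (by omega) s hs (by omega)
      by_contra! hneg
      obtain ⟨C, hC⟩ := hb k hk.le
      refine not_bounded_of_mul_le_deriv (hW k hk) hC (neg_pos.2 hneg) hs fun t ht => ?_
      rw [mul_neg, neg_le_neg_iff]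
      exact mul_le_mul_of_nonneg_left (hanti hs (hs.trans ht) ht) (hs.trans ht)
  have hanti : AntitoneOn (W 0) (Ici 0) := antitoneOn_of_hasDerivAt_neg_mul (hW 0 hm) (hsign 0 hm)
  by_contra! hneg
  obtain ⟨C, hC⟩ := hb 0 (Nat.zero_le m)
  obtain ⟨t, ht, hmin⟩ := (isCompact_Icc (a := -C) (b := W 0 0)).exists_isMinOn
    ⟨W 0 0, (abs_le.1 (hC 0)).1, le_rfl⟩ hgc.continuousOn
  obtain ⟨n, rfl⟩ : ∃ n, m = n + 1 := ⟨m - 1, by omega⟩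
  obtain ⟨D, hD⟩ := hb n (by omega)
  refine not_bounded_of_mul_le_deriv (f := fun s => -W n s) (f' := fun s => s * W (n + 1) s)
    (fun s => ((hW n (by omega) s).neg).congr_deriv (neg_neg _)) (fun s => by simpa using hD s)
    (hg_pos t (ht.2.trans_lt hneg)) le_rfl fun s hs => mul_le_mul_of_nonneg_left ?_ hs
  exact (hmin ⟨(abs_le.1 (hC s)).1, hanti self_mem_Ici hs hs⟩).trans (hg s)

end OrdinaryDifferential

/-- If `g : ℝ → ℝ` is convex and nonnegative with `g(s) > 0` for `s < 0`, then every
classical bounded solution `v` of `(-Δ)^m v = g(v)` in `ℝ^N` (with all partial derivatives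
of order `≤ 2m` bounded) is nonnegative. -/
theorem stmt_15 {N m : ℕ} (hN : 0 < N) (hm : 0 < m) (g : ℝ → ℝ)
    (hg_conv : ConvexOn ℝ Set.univ g)
    (hg_nonneg : ∀ s : ℝ, 0 ≤ g s) (hg_pos : ∀ s : ℝ, s < 0 → 0 < g s)
    (v : EuclideanSpace ℝ (Fin N) → ℝ)
    (hv : ContDiff ℝ (2 * m : ℕ) v)
    (hbdd : ∀ j : ℕ, j ≤ 2 * m → ∃ C : ℝ, ∀ x : EuclideanSpace ℝ (Fin N),
      ‖iteratedFDeriv ℝ j v x‖ ≤ C)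
    (heq : ∀ x : EuclideanSpace ℝ (Fin N), polyLap m v x = g (v x)) :
    ∀ x : EuclideanSpace ℝ (Fin N), 0 ≤ v x := by
  intro x
  have hB : BddSmooth (2 * m) v := ⟨hv, hbdd⟩
  have h0 (k : ℕ) (hk : k ≤ m) : BddSmooth 0 (lap^[k] v) :=
    (hB.iterate_lap k hk).mono (Nat.zero_le _)
  have key := nonneg_of_bounded_chain hm
    (W := fun k s => (-1) ^ k * gaussianAverage (lap^[k] v) x s) (g := g)
    (fun k hk => ?_) (fun k hk s => ?_)
    (continuousOn_univ.1 (hg_conv.continuousOn isOpen_univ)) hg_nonneg hg_pos fun s => ?_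
  · simpa [gaussianAverage_zero] using key
  · obtain ⟨C, hC⟩ := (h0 k hk).exists_abs_le
    exact ⟨C, fun s => by simpa [abs_mul] using abs_gaussianAverage_le hC x s⟩
  · have h2 : BddSmooth 2 (lap^[k] v) := (hB.iterate_lap k hk.le).mono (by omega)
    refine ((hasDerivAt_gaussianAverage h2 x s).const_mul ((-1) ^ k)).congr_deriv ?_
    rw [Function.iterate_succ_apply']
    ring
  · have h := map_gaussianAverage_le (h0 0 (Nat.zero_le m)) hg_conv x s
    simp only [gaussianAverage, ← heq, polyLap, Function.iterate_zero, id, pow_zero, one_mul,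
      integral_const_mul] at h ⊢
    exact h
end

section
/- Let N ≥ 2. There exists a constant c = c_N > 0, depending only on N, such that for every R > 0 and every x = (x₁, 0, …, 0) ∈ ℝ^N with 0 < x₁ ≤ R/2, one has ∫_{S_R} |x−y|^{−N} dσ(y) ≤ c/x₁, where S_R = {y ∈ ℝ^N : |y − P_R| = R} is the sphere of radius R centered at P_R = (R,0,…,0) and σ is the (N−1)-dimensional surface (Hausdorff) measure on S_R. -/
open MeasureTheory

/-- The point `P_R = (R,0,…,0)` in `ℝ^N`. -/
noncomputable def PP (N : ℕ) [NeZero N] (R : ℝ) : EuclideanSpace ℝ (Fin N) :=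
  EuclideanSpace.single 0 R

open scoped ENNReal NNReal

/-- If `a ^ 2 + A = b ^ 2 + B = R ^ 2`, with `a` and `b` large and of the same sign, then a bound on
`A - B` gives a bound on `b - a`. -/
lemma sq_sub_le_of_sq_add_eq {a b A B R S n : ℝ} (hR : 0 < R) (hn : 0 ≤ n) (hS : 0 ≤ S)
    (hA : a ^ 2 + A = R ^ 2) (hB : b ^ 2 + B = R ^ 2)
    (hAB : (A - B) ^ 2 ≤ S * (2 * A + 2 * B))
    (ha : R ^ 2 ≤ n * a ^ 2) (hb : R ^ 2 ≤ n * b ^ 2) (hab : 0 ≤ a * b) :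
    (b - a) ^ 2 ≤ n * S := by
  have h3 : ((b - a) * (b + a)) ^ 2 ≤ S * (4 * R ^ 2) := by
    have e : (b - a) * (b + a) = A - B := by linear_combination hB - hA
    rw [e]
    exact hAB.trans (mul_le_mul_of_nonneg_left (by linarith [sq_nonneg a, sq_nonneg b]) hS)
  have hnab : R ^ 2 ≤ n * (a * b) := by
    refine (abs_le_of_sq_le_sq' ?_ (mul_nonneg hn hab)).2
    calc (R ^ 2) ^ 2 = R ^ 2 * R ^ 2 := by ring
      _ ≤ (n * a ^ 2) * (n * b ^ 2) := by gcongr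
      _ = _ := by ring
  have h4 : 4 * R ^ 2 ≤ n * (b + a) ^ 2 := by linarith
  have h5 : (b - a) ^ 2 * (4 * R ^ 2) ≤ n * S * (4 * R ^ 2) :=
    calc (b - a) ^ 2 * (4 * R ^ 2) ≤ (b - a) ^ 2 * (n * (b + a) ^ 2) := by gcongr
      _ = n * ((b - a) * (b + a)) ^ 2 := by ring
      _ ≤ n * (S * (4 * R ^ 2)) := by gcongr
      _ = _ := by ring
  exact le_of_mul_le_mul_right h5 (by positivity)

/-- The map `ℝ^ι → ℝ^(ι \ {i})` forgetting the `i`-th coordinate. The target carries the sup norm. -/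
def dropCoord {ι : Type*} (i : ι) (y : EuclideanSpace ℝ ι) : {j // j ≠ i} → ℝ :=
  fun j => y j

/-- Forgetting the `i`-th coordinate is injective, with a quantitative inverse, on each of the two
parts of a sphere on which the `i`-th coordinate has a definite sign and is large. -/
lemma dist_le_card_mul_dist_restrict {ι : Type*} [Fintype ι] [DecidableEq ι] {i : ι}
    {p y z : EuclideanSpace ℝ ι} {R : ℝ} (hR : 0 < R)
    (hy : y ∈ Metric.sphere p R) (hz : z ∈ Metric.sphere p R)
    (hyi : R ^ 2 ≤ Fintype.card ι * (y i - p i) ^ 2)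
    (hzi : R ^ 2 ≤ Fintype.card ι * (z i - p i) ^ 2)
    (hyz : 0 ≤ (y i - p i) * (z i - p i)) :
    dist y z ≤ Fintype.card ι * dist (dropCoord i y) (dropCoord i z) := by
  have split (f : ι → ℝ) : ∑ j, f j = f i + ∑ j : {j // j ≠ i}, f j :=
    Fintype.sum_eq_add_sum_subtype_ne f i
  set D := dist (dropCoord i y) (dropCoord i z) with hD
  rw [Metric.mem_sphere, EuclideanSpace.dist_eq, Real.sqrt_eq_iff_mul_self_eq_of_pos hR] at hy hz
  simp only [Real.dist_eq, sq_abs] at hy hz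
  rw [split] at hy hz
  set n : ℝ := (Fintype.card ι : ℝ) with hn
  have hcard : (Fintype.card {j // j ≠ i} : ℝ) = n - 1 := by
    have : 0 < Fintype.card ι := Fintype.card_pos_iff.mpr ⟨i⟩
    simp [Fintype.card_subtype_compl, hn, Nat.cast_sub (Nat.succ_le_of_lt this)]
  have hD0 : 0 ≤ D := dist_nonneg
  have hn0 : 0 ≤ n := by positivity
  have hS : ∑ j : {j // j ≠ i}, (y j - z j) ^ 2 ≤ (n - 1) * D ^ 2 := by
    calc ∑ j : {j // j ≠ i}, (y j - z j) ^ 2 ≤ ∑ j : {j // j ≠ i}, D ^ 2 := by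
          refine Finset.sum_le_sum fun j _ => ?_
          rw [← sq_abs (y j - z j), ← Real.dist_eq]
          gcongr
          exact dist_le_pi_dist (dropCoord i y) (dropCoord i z) j
      _ = (n - 1) * D ^ 2 := by simp [← hcard]
  have hCS := Finset.sum_mul_sq_le_sq_mul_sq Finset.univ
    (fun j : {j // j ≠ i} => y j - z j) (fun j => (y j - p j) + (z j - p j))
  have h1 : ∑ j : {j // j ≠ i}, (y j - z j) * ((y j - p j) + (z j - p j)) =
      ∑ j : {j // j ≠ i}, (y j - p j) ^ 2 - ∑ j : {j // j ≠ i}, (z j - p j) ^ 2 := by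
    rw [← Finset.sum_sub_distrib]
    exact Finset.sum_congr rfl fun j _ => by ring
  have h2 : ∑ j : {j // j ≠ i}, ((y j - p j) + (z j - p j)) ^ 2 ≤
      2 * ∑ j : {j // j ≠ i}, (y j - p j) ^ 2 + 2 * ∑ j : {j // j ≠ i}, (z j - p j) ^ 2 := by
    rw [Finset.mul_sum, Finset.mul_sum, ← Finset.sum_add_distrib]
    exact Finset.sum_le_sum fun j _ => by nlinarith [sq_nonneg ((y j - p j) - (z j - p j))]
  rw [h1] at hCS
  set S := ∑ j : {j // j ≠ i}, (y j - z j) ^ 2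
  have hS0 : 0 ≤ S := Finset.sum_nonneg fun j _ => sq_nonneg _
  set A := ∑ j : {j // j ≠ i}, (y j - p j) ^ 2
  set B := ∑ j : {j // j ≠ i}, (z j - p j) ^ 2
  set a := y i - p i with ha
  set b := z i - p i with hb
  have h5 : (b - a) ^ 2 ≤ n * S := sq_sub_le_of_sq_add_eq hR hn0 hS0 (by linarith) (by linarith)
    (hCS.trans (mul_le_mul_of_nonneg_left h2 hS0)) hyi hzi hyz
  rw [EuclideanSpace.dist_eq]
  refine Real.sqrt_le_iff.mpr ⟨by positivity, ?_⟩
  simp only [Real.dist_eq, sq_abs]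
  rw [split]
  have e : (y i - z i) ^ 2 = (b - a) ^ 2 := by rw [ha, hb]; ring
  rw [e]
  calc (b - a) ^ 2 + S ≤ (n + 1) * S := by linarith
    _ ≤ (n + 1) * ((n - 1) * D ^ 2) := by gcongr
    _ = (n * D) ^ 2 - D ^ 2 := by ring
    _ ≤ (n * D) ^ 2 := sub_le_self _ (sq_nonneg D)

/-- Hausdorff measure of a set on which forgetting one coordinate expands by at most `1 / K`. -/
lemma hausdorffMeasure_le_of_dist_restrict {ι : Type*} [Fintype ι] [DecidableEq ι] {i : ι} {K : ℝ≥0}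
    {s : Set (EuclideanSpace ℝ ι)} {x : EuclideanSpace ℝ ι} {r : ℝ} (hr : 0 ≤ r)
    (hsr : s ⊆ Metric.closedBall x r)
    (hs : ∀ y ∈ s, ∀ z ∈ s, dist y z ≤ K * dist (dropCoord i y) (dropCoord i z)) :
    μH[(Fintype.card ι : ℝ) - 1] s ≤
      ENNReal.ofReal ((K * (2 * r)) ^ (Fintype.card ι - 1)) := by
  have hpos : 0 < Fintype.card ι := Fintype.card_pos_iff.mpr ⟨i⟩
  have hcard : Fintype.card {j // j ≠ i} = Fintype.card ι - 1 := by
    simp [Fintype.card_subtype_compl]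
  have hdim : (Fintype.card ι : ℝ) - 1 = (Fintype.card {j // j ≠ i} : ℝ) := by
    rw [hcard, Nat.cast_sub (Nat.succ_le_of_lt hpos), Nat.cast_one]
  have hinj : Set.InjOn (dropCoord i) s := fun y hy z hz h => by
    have := hs y hy z hz
    rw [h, dist_self, mul_zero] at this
    exact dist_le_zero.mp this
  have : Nonempty (EuclideanSpace ℝ ι) := ⟨x⟩
  have hleft := hinj.leftInvOn_invFunOn
  have hlip : LipschitzOnWith K (Function.invFunOn (dropCoord i) s) (dropCoord i '' s) := by
    refine LipschitzOnWith.of_dist_le_mul ?_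
    rintro _ ⟨y, hy, rfl⟩ _ ⟨z, hz, rfl⟩
    rw [hleft hy, hleft hz]
    exact hs y hy z hz
  have himg : dropCoord i '' s ⊆ Metric.closedBall (dropCoord i x) r := by
    rintro _ ⟨y, hy, rfl⟩
    refine (dist_pi_le_iff hr).mpr fun j => ?_
    exact (PiLp.dist_apply_le y x j).trans (hsr hy)
  rw [hdim]
  calc μH[(Fintype.card {j // j ≠ i} : ℝ)] s
      = μH[(Fintype.card {j // j ≠ i} : ℝ)] (Function.invFunOn (dropCoord i) s '' (dropCoord i '' s)) := by
        rw [hleft.image_image]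
    _ ≤ (K : ℝ≥0∞) ^ (Fintype.card {j // j ≠ i} : ℝ) *
          μH[(Fintype.card {j // j ≠ i} : ℝ)] (dropCoord i '' s) :=
        hlip.hausdorffMeasure_image_le (by positivity)
    _ ≤ (K : ℝ≥0∞) ^ (Fintype.card {j // j ≠ i} : ℝ) * volume (Metric.closedBall (dropCoord i x) r) := by
        rw [hausdorffMeasure_pi_real]
        gcongr
    _ = _ := by
        rw [Real.volume_pi_closedBall _ hr, ENNReal.rpow_natCast, hcard, mul_pow (K : ℝ),
          ENNReal.ofReal_mul (by positivity), ENNReal.ofReal_pow K.coe_nonneg,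
          ENNReal.ofReal_coe_nnreal]

/-- Upper Ahlfors regularity of spheres, uniformly in the radius. -/
lemma hausdorffMeasure_sphere_inter_closedBall_le {ι : Type*} [Fintype ι]
    (p x : EuclideanSpace ℝ ι) {R r : ℝ} (hR : 0 < R) (hr : 0 ≤ r) :
    μH[(Fintype.card ι : ℝ) - 1] (Metric.sphere p R ∩ Metric.closedBall x r) ≤
      ENNReal.ofReal (2 * Fintype.card ι * (Fintype.card ι * (2 * r)) ^ (Fintype.card ι - 1)) := by
  classical
  let piece (i : ι) (b : Bool) : Set (EuclideanSpace ℝ ι) :=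
    {y | y ∈ Metric.sphere p R ∩ Metric.closedBall x r ∧
      R ^ 2 ≤ Fintype.card ι * (y i - p i) ^ 2 ∧ 0 ≤ (if b then 1 else -1) * (y i - p i)}
  have hcover : Metric.sphere p R ∩ Metric.closedBall x r ⊆ ⋃ q : ι × Bool, piece q.1 q.2 := by
    intro y hy
    have hyR := hy.1
    rw [Metric.mem_sphere, EuclideanSpace.dist_eq,
      Real.sqrt_eq_iff_mul_self_eq_of_pos hR] at hyR
    simp only [Real.dist_eq, sq_abs] at hyR
    obtain ⟨i, hi⟩ : ∃ i, R ^ 2 ≤ Fintype.card ι * (y i - p i) ^ 2 := by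
      by_contra! h
      have hne : Nonempty ι := by
        by_contra hemp
        rw [not_nonempty_iff] at hemp
        simp at hyR
        exact hR.ne' hyR
      have := Finset.sum_lt_sum_of_nonempty Finset.univ_nonempty fun i (_ : i ∈ Finset.univ) => h i
      rw [← Finset.mul_sum, ← hyR] at this
      simp [sq] at this
    rcases le_total 0 (y i - p i) with h | h
    · exact Set.mem_iUnion.mpr ⟨(i, true), hy, hi, by simpa using h⟩
    · exact Set.mem_iUnion.mpr ⟨(i, false), hy, hi, by simpa using h⟩
  have hpiece (q : ι × Bool) : μH[(Fintype.card ι : ℝ) - 1] (piece q.1 q.2) ≤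
      ENNReal.ofReal ((Fintype.card ι * (2 * r)) ^ (Fintype.card ι - 1)) := by
    have := hausdorffMeasure_le_of_dist_restrict (i := q.1) (K := (Fintype.card ι : ℝ≥0))
      (s := piece q.1 q.2) hr (fun y hy => hy.1.2) ?_
    · simpa using this
    · intro y hy z hz
      have := dist_le_card_mul_dist_restrict hR hy.1.1 hz.1.1 hy.2.1 hz.2.1 ?_
      · simpa using this
      · have := mul_nonneg hy.2.2 hz.2.2
        cases h : q.2 <;> simp only [h] at this <;> norm_num at this <;> linarith
  calc μH[(Fintype.card ι : ℝ) - 1] (Metric.sphere p R ∩ Metric.closedBall x r)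
      ≤ ∑ q : ι × Bool, μH[(Fintype.card ι : ℝ) - 1] (piece q.1 q.2) :=
        (measure_mono hcover).trans (measure_iUnion_fintype_le _ _)
    _ ≤ ∑ q : ι × Bool, ENNReal.ofReal ((Fintype.card ι * (2 * r)) ^ (Fintype.card ι - 1)) :=
        Finset.sum_le_sum fun q _ => hpiece q
    _ = _ := by
        rw [Finset.sum_const, nsmul_eq_mul, ENNReal.ofReal_mul (by positivity)]
        congr 1
        rw [Finset.card_univ, Fintype.card_prod, Fintype.card_bool, ENNReal.ofReal_mul (by simp)]
        simp [mul_comm]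

/-- Dyadic summation: if a measure has `n`-dimensional growth around `x` and does not charge the
ball of radius `δ` around `x`, then the integral of `dist y x ^ (-(n + 1))` is `O(1 / δ)`. -/
lemma lintegral_dist_inv_pow_le {X : Type*} [PseudoMetricSpace X] [MeasurableSpace X]
    [OpensMeasurableSpace X] {μ : Measure X} {x : X} {n : ℕ} {C δ : ℝ} (hC : 0 ≤ C) (hδ : 0 < δ)
    (hμ : ∀ r : ℝ, 0 < r → μ (Metric.closedBall x r) ≤ ENNReal.ofReal (C * r ^ n))
    (hsupp : ∀ᵐ y ∂μ, δ ≤ dist y x) :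
    ∫⁻ y, ENNReal.ofReal ((dist y x ^ (n + 1))⁻¹) ∂μ ≤ ENNReal.ofReal (C * 2 ^ (n + 1) / δ) := by
  have hpt : ∀ᵐ y ∂μ, ENNReal.ofReal ((dist y x ^ (n + 1))⁻¹) ≤
      ∑' k : ℕ, (Metric.closedBall x (2 ^ (k + 1) * δ)).indicator
        (fun _ => ENNReal.ofReal (((2 ^ k * δ) ^ (n + 1))⁻¹)) y := by
    filter_upwards [hsupp] with y hy
    obtain ⟨k, hk, hk'⟩ := exists_nat_pow_near (x := dist y x / δ) (y := (2 : ℝ))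
      ((one_le_div hδ).mpr hy) one_lt_two
    rw [le_div_iff₀ hδ] at hk
    rw [div_lt_iff₀ hδ] at hk'
    refine le_trans ?_ (ENNReal.le_tsum k)
    rw [Set.indicator_of_mem (Metric.mem_closedBall.mpr hk'.le)]
    gcongr
  calc ∫⁻ y, ENNReal.ofReal ((dist y x ^ (n + 1))⁻¹) ∂μ
      ≤ ∫⁻ y, ∑' k : ℕ, (Metric.closedBall x (2 ^ (k + 1) * δ)).indicator
        (fun _ => ENNReal.ofReal (((2 ^ k * δ) ^ (n + 1))⁻¹)) y ∂μ := lintegral_mono_ae hpt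
    _ = ∑' k : ℕ, ENNReal.ofReal (((2 ^ k * δ) ^ (n + 1))⁻¹) *
          μ (Metric.closedBall x (2 ^ (k + 1) * δ)) := by
        rw [lintegral_tsum fun k =>
          (measurable_const.indicator Metric.isClosed_closedBall.measurableSet).aemeasurable]
        simp_rw [lintegral_indicator_const Metric.isClosed_closedBall.measurableSet]
    _ ≤ ∑' k : ℕ, ENNReal.ofReal (C * 2 ^ n / δ * (1 / 2) ^ k) := by
        refine ENNReal.tsum_le_tsum fun k => ?_
        calc ENNReal.ofReal (((2 ^ k * δ) ^ (n + 1))⁻¹) *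
              μ (Metric.closedBall x (2 ^ (k + 1) * δ))
            ≤ ENNReal.ofReal (((2 ^ k * δ) ^ (n + 1))⁻¹) *
              ENNReal.ofReal (C * (2 ^ (k + 1) * δ) ^ n) := by
              gcongr
              exact hμ _ (by positivity)
          _ = _ := by
              rw [← ENNReal.ofReal_mul (by positivity)]
              congr 1
              rw [pow_succ 2 k, mul_right_comm, mul_pow _ (2 : ℝ) n, pow_succ _ n, one_div, inv_pow]
              field_simp
    _ = ENNReal.ofReal (C * 2 ^ (n + 1) / δ) := by
        rw [← ENNReal.ofReal_tsum_of_nonneg (fun k => by positivity)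
          (summable_geometric_two.mul_left _), tsum_mul_left, tsum_geometric_two]
        congr 1
        ring

/-- Uniform surface-integral bound: there is `c = c_N > 0` such that for every `R > 0`
and every point `x = (x₁,0,…,0)` with `0 < x₁ ≤ R/2`,
`∫_{S_R} |x-y|^{-N} dσ(y) ≤ c/x₁`, where `S_R` is the sphere of radius `R` centered at
`P_R = (R,0,…,0)` and `σ` is the `(N-1)`-dimensional Hausdorff measure. -/
theorem stmt_18 {N : ℕ} [NeZero N] (hN : 2 ≤ N) :
    ∃ c : ℝ, 0 < c ∧ ∀ R x₁ : ℝ, 0 < R → 0 < x₁ → x₁ ≤ R / 2 →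
      (∫ y in Metric.sphere (PP N R) R,
          ‖(EuclideanSpace.single 0 x₁ : EuclideanSpace ℝ (Fin N)) - y‖ ^ (-(N : ℝ))
          ∂μH[(N : ℝ) - 1]) ≤ c / x₁ := by
  obtain ⟨n, rfl⟩ : ∃ n, N = n + 1 := ⟨N - 1, by omega⟩
  set N := n + 1 with hNn
  set C : ℝ := 2 * N * (N * 2) ^ n with hC
  have hC0 : 0 < C := by positivity
  refine ⟨C * 2 ^ (n + 1), by positivity, fun R x₁ hR hx hxR => ?_⟩
  set x : EuclideanSpace ℝ (Fin N) := EuclideanSpace.single 0 x₁ with hxdef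
  have hxP : dist x (PP N R) = R - x₁ := by
    rw [hxdef, PP, PiLp.dist_single_same, Real.dist_eq, abs_of_nonpos (by linarith)]
    ring
  have hgrowth (r : ℝ) (hr : 0 < r) :
      (μH[(N : ℝ) - 1].restrict (Metric.sphere (PP N R) R)) (Metric.closedBall x r) ≤
        ENNReal.ofReal (C * r ^ n) := by
    rw [Measure.restrict_apply Metric.isClosed_closedBall.measurableSet, Set.inter_comm]
    have := hausdorffMeasure_sphere_inter_closedBall_le (PP N R) x hR hr.le
    rw [Fintype.card_fin] at this
    refine this.trans_eq ?_
    rw [hC, hNn, Nat.add_sub_cancel]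
    congr 1
    ring
  have hsupp : ∀ᵐ y ∂(μH[(N : ℝ) - 1].restrict (Metric.sphere (PP N R) R)), x₁ ≤ dist y x := by
    filter_upwards [ae_restrict_mem Metric.isClosed_sphere.measurableSet] with y hy
    have := dist_triangle y x (PP N R)
    rw [hxP, Metric.mem_sphere.mp hy] at this
    linarith
  have hbound := lintegral_dist_inv_pow_le hC0.le hx hgrowth hsupp
  refine (Real.le_norm_self _).trans ?_
  rw [← ENNReal.ofReal_le_ofReal_iff (by positivity), ofReal_norm]
  refine (enorm_integral_le_lintegral_enorm _).trans (le_trans (le_of_eq ?_) hbound)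
  refine lintegral_congr fun y => ?_
  rw [Real.enorm_of_nonneg (by positivity), Real.rpow_neg (norm_nonneg _), Real.rpow_natCast,
    dist_comm, dist_eq_norm]
end

section
/- Let N ≥ 1 and m ≥ 1 be integers and let q > 1. If u is a bounded classical solution of the half-space Dirichlet problem (−Δ)^m u = u^q with u ≥ 0 and u is not identically zero, then u(x) > 0 for every x ∈ ℝ^N_+. -/
/-- The first coordinate vector `e₁ = (1,0,…,0)` of `ℝ^N`. -/
noncomputable def e1 (N : ℕ) [NeZero N] : EuclideanSpace ℝ (Fin N) :=
  EuclideanSpace.single 0 1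

/-- `u` is a bounded classical solution of the half-space Dirichlet problem
`(-Δ)^m u = u^q`. -/
def IsBCSol (N m : ℕ) [NeZero N] (q : ℝ) (u : EuclideanSpace ℝ (Fin N) → ℝ) : Prop :=
  ContDiffOn ℝ (2 * m : ℕ) u {x : EuclideanSpace ℝ (Fin N) | 0 < x 0} ∧
  ContDiffOn ℝ (2 * m - 1 : ℕ) u {x : EuclideanSpace ℝ (Fin N) | 0 ≤ x 0} ∧
  (∀ j : ℕ, j ≤ 2 * m - 1 → ∃ C : ℝ, ∀ x : EuclideanSpace ℝ (Fin N), 0 ≤ x 0 →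
    ‖iteratedFDerivWithin ℝ j u {y : EuclideanSpace ℝ (Fin N) | 0 ≤ y 0} x‖ ≤ C) ∧
  (∀ x : EuclideanSpace ℝ (Fin N), 0 < x 0 → polyLap m u x = u x ^ q) ∧
  (∀ j : ℕ, j < m → ∀ x : EuclideanSpace ℝ (Fin N), x 0 = 0 →
    iteratedFDerivWithin ℝ j u {y : EuclideanSpace ℝ (Fin N) | 0 ≤ y 0} x (fun _ => e1 N) = 0)

section

open Set Filter Topology

/-- The open half-space `{x | 0 < x 0}`. -/
def halfSpace (N : ℕ) [NeZero N] : Set (EuclideanSpace ℝ (Fin N)) := {x | 0 < x 0}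

/-- `k`-fold continuous differentiability on the open half-space. -/
def SmoothHS {N : ℕ} [NeZero N] (k : ℕ) (w : EuclideanSpace ℝ (Fin N) → ℝ) : Prop :=
  ContDiffOn ℝ k w (halfSpace N)

/-- The `i`-th partial derivative. -/
noncomputable def pd {N : ℕ} (i : Fin N) (w : EuclideanSpace ℝ (Fin N) → ℝ) :
    EuclideanSpace ℝ (Fin N) → ℝ :=
  fun x => fderiv ℝ w x (EuclideanSpace.single i 1)

/-- The Laplacian as the sum of the second partial derivatives. -/
noncomputable def lapl {N : ℕ} (w : EuclideanSpace ℝ (Fin N) → ℝ) :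
    EuclideanSpace ℝ (Fin N) → ℝ :=
  fun x => ∑ i, pd i (pd i w) x

/-- The degenerate elliptic operator `x₀² Δ - c x₀ ∂₀ + d`. -/
noncomputable def opA {N : ℕ} [NeZero N] (c d : ℝ) (w : EuclideanSpace ℝ (Fin N) → ℝ) :
    EuclideanSpace ℝ (Fin N) → ℝ :=
  fun x => x 0 ^ 2 * lapl w x - c * x 0 * pd 0 w x + d * w x

section Calculus

variable {N : ℕ} [NeZero N] {f g w : EuclideanSpace ℝ (Fin N) → ℝ}

lemma isOpen_halfSpace : IsOpen (halfSpace N) :=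
  isOpen_lt continuous_const (by fun_prop)

lemma SmoothHS.mono {k l : ℕ} (h : SmoothHS l w) (hkl : k ≤ l) : SmoothHS k w :=
  ContDiffOn.of_le h (by exact_mod_cast hkl)

lemma SmoothHS.contDiffAt {k : ℕ} (h : SmoothHS k w) {x : EuclideanSpace ℝ (Fin N)}
    (hx : x ∈ halfSpace N) : ContDiffAt ℝ k w x :=
  ContDiffOn.contDiffAt h (isOpen_halfSpace.mem_nhds hx)

lemma SmoothHS.differentiableAt {k : ℕ} (h : SmoothHS (k + 1) w)
    {x : EuclideanSpace ℝ (Fin N)} (hx : x ∈ halfSpace N) : DifferentiableAt ℝ w x :=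
  (h.contDiffAt hx).differentiableAt (by norm_cast)

lemma SmoothHS.congr {k : ℕ} (h : SmoothHS k f) (hfg : EqOn f g (halfSpace N)) : SmoothHS k g :=
  ContDiffOn.congr h hfg.symm

lemma SmoothHS.add {k : ℕ} (hf : SmoothHS k f) (hg : SmoothHS k g) :
    SmoothHS k (fun x => f x + g x) := ContDiffOn.add hf hg

lemma SmoothHS.sub {k : ℕ} (hf : SmoothHS k f) (hg : SmoothHS k g) :
    SmoothHS k (fun x => f x - g x) := ContDiffOn.sub hf hg

lemma SmoothHS.mul {k : ℕ} (hf : SmoothHS k f) (hg : SmoothHS k g) :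
    SmoothHS k (fun x => f x * g x) := ContDiffOn.mul hf hg

lemma SmoothHS.const {k : ℕ} (c : ℝ) :
    SmoothHS k (fun _ : EuclideanSpace ℝ (Fin N) => c) := contDiffOn_const

lemma SmoothHS.coord {k : ℕ} : SmoothHS k (fun x : EuclideanSpace ℝ (Fin N) => x 0) := by
  have : ContDiff ℝ k (fun x : EuclideanSpace ℝ (Fin N) => x 0) := by fun_prop
  exact this.contDiffOn

lemma SmoothHS.pd {k : ℕ} (h : SmoothHS (k + 1) w) (i : Fin N) : SmoothHS k (pd i w) := by
  have h1 : ContDiffOn ℝ k (fderiv ℝ w) (halfSpace N) :=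
    ContDiffOn.fderiv_of_isOpen h isOpen_halfSpace (by norm_cast)
  exact h1.clm_apply contDiffOn_const

lemma SmoothHS.lapl {k : ℕ} (h : SmoothHS (k + 2) w) : SmoothHS k (lapl w) :=
  ContDiffOn.sum fun i _ => SmoothHS.pd (SmoothHS.pd h i) i

lemma SmoothHS.opA {k : ℕ} (h : SmoothHS (k + 2) w) (c d : ℝ) : SmoothHS k (opA c d w) := by
  have h1 : SmoothHS k w := h.mono (by omega)
  have h2 : SmoothHS k (_root_.pd 0 w) := SmoothHS.pd (h.mono (by omega)) 0
  have h3 : SmoothHS k (_root_.lapl w) := h.lapl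
  unfold _root_.opA SmoothHS at *
  have h4 : ContDiff ℝ k (fun x : EuclideanSpace ℝ (Fin N) => x 0) := by fun_prop
  fun_prop

lemma pd_congr (h : EqOn f g (halfSpace N)) (i : Fin N) :
    EqOn (pd i f) (pd i g) (halfSpace N) := fun x hx => by
  have : f =ᶠ[𝓝 x] g := h.eventuallyEq_of_mem (isOpen_halfSpace.mem_nhds hx)
  simp only [pd, this.fderiv_eq]

lemma lapl_congr (h : EqOn f g (halfSpace N)) :
    EqOn (lapl f) (lapl g) (halfSpace N) := fun _ hx =>
  Finset.sum_congr rfl fun i _ => pd_congr (pd_congr h i) i hx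

lemma lapl_iterate_congr (h : EqOn f g (halfSpace N)) (k : ℕ) :
    EqOn (lapl^[k] f) (lapl^[k] g) (halfSpace N) := by
  induction k generalizing f g with
  | zero => exact h
  | succ k ih => exact ih (lapl_congr h)

lemma opA_congr (h : EqOn f g (halfSpace N)) (c d : ℝ) :
    EqOn (opA c d f) (opA c d g) (halfSpace N) := fun x hx => by
  simp only [opA, lapl_congr h hx, pd_congr h 0 hx, h hx]

lemma pd_lin (hf : SmoothHS 1 f) (hg : SmoothHS 1 g) (a b : ℝ) (i : Fin N) :
    EqOn (pd i (fun x => a * f x + b * g x)) (fun x => a * pd i f x + b * pd i g x)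
      (halfSpace N) := fun x hx => by
  have h1 := (hf.differentiableAt hx).hasFDerivAt.const_mul a
  have h2 := (hg.differentiableAt hx).hasFDerivAt.const_mul b
  simp only [pd]
  rw [(h1.fun_add h2).fderiv]
  simp

lemma lapl_lin (hf : SmoothHS 2 f) (hg : SmoothHS 2 g) (a b : ℝ) :
    EqOn (lapl (fun x => a * f x + b * g x)) (fun x => a * lapl f x + b * lapl g x)
      (halfSpace N) := fun x hx => by
  simp only [lapl]
  rw [Finset.mul_sum, Finset.mul_sum, ← Finset.sum_add_distrib]
  refine Finset.sum_congr rfl fun i _ => ?_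
  rw [pd_congr (pd_lin (hf.mono (by omega)) (hg.mono (by omega)) a b i) i hx]
  exact pd_lin (hf.pd i) (hg.pd i) a b i hx

lemma opA_lin (hf : SmoothHS 2 f) (hg : SmoothHS 2 g) (a b c d : ℝ) :
    EqOn (opA c d (fun x => a * f x + b * g x)) (fun x => a * opA c d f x + b * opA c d g x)
      (halfSpace N) := fun x hx => by
  simp only [opA]
  rw [lapl_lin hf hg a b hx, pd_lin (hf.mono (by omega)) (hg.mono (by omega)) a b 0 hx]
  ring

lemma pd_mul (hf : SmoothHS 1 f) (hg : SmoothHS 1 g) (i : Fin N) :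
    EqOn (pd i (fun x => f x * g x)) (fun x => f x * pd i g x + pd i f x * g x)
      (halfSpace N) := fun x hx => by
  have h1 := (hf.differentiableAt hx).hasFDerivAt
  have h2 := (hg.differentiableAt hx).hasFDerivAt
  simp only [pd]
  rw [(h1.fun_mul h2).fderiv]
  simp [mul_comm]

omit [NeZero N] in
lemma pd_coord (i : Fin N) (x : EuclideanSpace ℝ (Fin N)) (j : Fin N) :
    pd i (fun x : EuclideanSpace ℝ (Fin N) => x j) x = if i = j then 1 else 0 := by
  have : HasFDerivAt (fun x : EuclideanSpace ℝ (Fin N) => x j)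
    (EuclideanSpace.proj j : EuclideanSpace ℝ (Fin N) →L[ℝ] ℝ) x :=
    (EuclideanSpace.proj j : EuclideanSpace ℝ (Fin N) →L[ℝ] ℝ).hasFDerivAt
  simp only [pd, this.fderiv]
  simp [eq_comm]

lemma pd_coord_mul (hw : SmoothHS 1 w) (i : Fin N) :
    EqOn (pd i (fun x => x 0 * w x)) (fun x => x 0 * pd i w x + (if i = 0 then 1 else 0) * w x)
      (halfSpace N) := fun x hx => by
  rw [pd_mul SmoothHS.coord hw i hx]
  simp only [pd_coord]

lemma lapl_coord_mul (hw : SmoothHS 2 w) :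
    EqOn (lapl (fun x => x 0 * w x)) (fun x => x 0 * lapl w x + 2 * pd 0 w x)
      (halfSpace N) := fun x hx => by
  have key : ∀ i : Fin N, pd i (pd i (fun x => x 0 * w x)) x
      = x 0 * pd i (pd i w) x + if i = 0 then 2 * pd 0 w x else 0 := by
    intro i
    rw [pd_congr (pd_coord_mul (hw.mono (by omega)) i) i hx]
    have h1 : SmoothHS 1 (fun x => x 0 * pd i w x) := SmoothHS.coord.mul (hw.pd i)
    have := pd_lin h1 (hw.mono (by omega) : SmoothHS 1 w) 1 (if i = 0 then 1 else 0) i hx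
    simp only [one_mul] at this
    rw [this, pd_coord_mul (hw.pd i) i hx]
    by_cases hi : i = 0
    · subst hi; simp; ring
    · simp [hi]
  simp only [lapl, key, Finset.sum_add_distrib, Finset.mul_sum]
  simp

lemma opA_coord_mul (hw : SmoothHS 2 w) (c d : ℝ) :
    EqOn (opA c d (fun x => x 0 * w x)) (fun x => x 0 * opA (c - 2) (d - c) w x)
      (halfSpace N) := fun x hx => by
  simp only [opA]
  rw [lapl_coord_mul hw hx, pd_coord_mul (hw.mono (by omega)) 0 hx]
  simp
  ring

lemma pd_comm (hw : SmoothHS 2 w) (i j : Fin N) :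
    EqOn (pd i (pd j w)) (pd j (pd i w)) (halfSpace N) := fun x hx => by
  have h : ContDiffAt ℝ 2 w x := hw.contDiffAt hx
  have hs : IsSymmSndFDerivAt ℝ w x := h.isSymmSndFDerivAt (by simp)
  have hd : DifferentiableAt ℝ (fderiv ℝ w) x :=
    (h.fderiv_right (m := 1) (by norm_num)).differentiableAt (by norm_num)
  have e : ∀ v v' : EuclideanSpace ℝ (Fin N),
      fderiv ℝ (fun y => fderiv ℝ w y v) x v' = fderiv ℝ (fderiv ℝ w) x v' v := by
    intro v v'
    rw [fderiv_clm_apply hd (differentiableAt_const v)]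
    simp
  unfold pd
  rw [e, e]
  exact hs.eq _ _

lemma pd_sum {ι : Type*} (s : Finset ι) (F : ι → EuclideanSpace ℝ (Fin N) → ℝ)
    (hF : ∀ k ∈ s, SmoothHS 1 (F k)) (i : Fin N) :
    EqOn (pd i (fun x => ∑ k ∈ s, F k x)) (fun x => ∑ k ∈ s, pd i (F k) x)
      (halfSpace N) := fun x hx => by
  simp only [pd]
  rw [fderiv_fun_sum fun k hk => (hF k hk).differentiableAt hx]
  simp

lemma pd_lapl (hw : SmoothHS 3 w) (i : Fin N) :
    EqOn (pd i (lapl w)) (lapl (pd i w)) (halfSpace N) := fun x hx => by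
  unfold lapl
  rw [pd_sum _ _ (fun k _ => SmoothHS.pd (SmoothHS.pd hw k) k) i hx]
  refine Finset.sum_congr rfl fun k _ => ?_
  rw [pd_comm (hw.pd k) i k hx]
  exact pd_congr (pd_comm (hw.mono (by omega)) i k) k hx

lemma lap_eq_lapl (hw : SmoothHS 2 w) : EqOn (lap w) (lapl w) (halfSpace N) := fun x hx => by
  unfold lap lapl
  refine Finset.sum_congr rfl fun i _ => ?_
  set v : EuclideanSpace ℝ (Fin N) := EuclideanSpace.single i 1
  have hline : ∀ s : ℝ, HasDerivAt (fun t : ℝ => x + t • v) v s := fun s => by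
    simpa using ((hasDerivAt_id s).smul_const v).const_add x
  have hmem : ∀ᶠ s : ℝ in 𝓝 0, x + s • v ∈ halfSpace N := by
    have : ContinuousAt (fun t : ℝ => x + t • v) 0 := (hline 0).continuousAt
    exact this.eventually_mem (isOpen_halfSpace.mem_nhds (by simpa using hx))
  rw [iteratedDeriv_succ, iteratedDeriv_one]
  have h1 : deriv (fun t : ℝ => w (x + t • v)) =ᶠ[𝓝 0] fun t => pd i w (x + t • v) := by
    filter_upwards [hmem] with s hs
    exact ((hw.differentiableAt hs).hasFDerivAt.comp_hasDerivAt s (hline s)).deriv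
  rw [h1.deriv_eq]
  have h0 : x + (0 : ℝ) • v ∈ halfSpace N := by simpa using hx
  have := (((SmoothHS.pd hw i).differentiableAt h0).hasFDerivAt.comp_hasDerivAt 0 (hline 0)).deriv
  simp only [zero_smul, add_zero] at this
  exact this

lemma lap_congr (h : EqOn f g (halfSpace N)) : EqOn (lap f) (lap g) (halfSpace N) :=
  fun x hx => by
  unfold lap
  refine Finset.sum_congr rfl fun i _ => ?_
  refine Filter.EventuallyEq.iteratedDeriv_eq _ ?_
  have hc : ContinuousAt (fun t : ℝ => x + t • (EuclideanSpace.single i (1 : ℝ))) 0 := by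
    fun_prop
  filter_upwards [hc.eventually_mem (isOpen_halfSpace.mem_nhds (by simpa using hx))] with s hs
  exact h hs

lemma SmoothHS.lapl_iterate {k l : ℕ} (hw : SmoothHS (k + 2 * l) w) :
    SmoothHS k (_root_.lapl^[l] w) := by
  induction l generalizing w with
  | zero => exact hw
  | succ l ih => exact ih (SmoothHS.lapl hw)

lemma lap_iterate_eq {k : ℕ} (hw : SmoothHS (2 * k) w) :
    EqOn (lap^[k] w) (lapl^[k] w) (halfSpace N) := by
  induction k with
  | zero => exact fun _ _ => rfl
  | succ k ih =>
    intro x hx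
    rw [Function.iterate_succ_apply', Function.iterate_succ_apply',
      lap_congr (ih (hw.mono (by omega))) hx]
    exact lap_eq_lapl (SmoothHS.lapl_iterate (hw.mono (by omega))) hx

end Calculus

section Factorization

variable {N : ℕ} [NeZero N] {w : EuclideanSpace ℝ (Fin N) → ℝ}

/-- The partial products `A_k ⋯ A_1 w`, where
`A_j = x₀² Δ - (2M - 2) x₀ ∂₀ + (M - j) (M - 1 + j)`. -/
noncomputable def partialProd (M : ℝ) (w : EuclideanSpace ℝ (Fin N) → ℝ) :
    ℕ → EuclideanSpace ℝ (Fin N) → ℝ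
  | 0 => w
  | k + 1 => opA (2 * M - 2) ((M - (k + 1)) * (M + k)) (partialProd M w k)

lemma SmoothHS.partialProd {k l : ℕ} (hw : SmoothHS (k + 2 * l) w) (M : ℝ) :
    SmoothHS k (partialProd M w l) := by
  induction l generalizing k with
  | zero => exact hw
  | succ l ih =>
    exact SmoothHS.opA (ih (k := k + 2) (hw.mono (by omega))) _ _

lemma opA_comm (hw : SmoothHS 4 w) (c d d' : ℝ) :
    EqOn (opA c d (opA c d' w)) (opA c d' (opA c d w)) (halfSpace N) := by
  have h0 : SmoothHS 2 (opA c 0 w) := SmoothHS.opA hw c 0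
  have h1 : SmoothHS 2 w := hw.mono (by omega)
  have key : ∀ a b : ℝ, EqOn (opA c a (opA c b w))
      (fun x => opA c 0 (opA c 0 w) x + (a + b) * opA c 0 w x + a * b * w x)
      (halfSpace N) := by
    intro a b x hx
    have e : opA c b w = fun x => 1 * opA c 0 w x + b * w x := by
      funext y; simp [opA]
    rw [e, opA_lin h0 h1 1 b c a hx]
    have e' : ∀ v : EuclideanSpace ℝ (Fin N) → ℝ, opA c a v x = opA c 0 v x + a * v x := by
      intro v; simp [opA]
    beta_reduce
    rw [e', e']
    ring
  intro x hx
  rw [key d d' hx, key d' d hx]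
  ring

lemma partialProd_opA {k : ℕ} (hw : SmoothHS (2 * k + 2) w) (M d : ℝ) :
    EqOn (partialProd M (opA (2 * M - 2) d w) k) (opA (2 * M - 2) d (partialProd M w k))
      (halfSpace N) := by
  induction k with
  | zero => exact fun _ _ => rfl
  | succ k ih =>
    intro x hx
    simp only [partialProd]
    rw [opA_congr (ih (hw.mono (by omega))) _ _ hx]
    exact opA_comm (SmoothHS.partialProd (hw.mono (by omega)) M) _ _ _ hx

lemma partialProd_coord_mul {k : ℕ} (hw : SmoothHS (2 * k) w) (M : ℝ) :
    EqOn (partialProd (M + 1) (fun x => x 0 * w x) k) (fun x => x 0 * partialProd M w k x)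
      (halfSpace N) := by
  induction k with
  | zero => exact fun _ _ => rfl
  | succ k ih =>
    intro x hx
    simp only [partialProd]
    rw [opA_congr (ih (hw.mono (by omega))) _ _ hx,
      opA_coord_mul (SmoothHS.partialProd (hw.mono (by omega)) M) _ _ hx]
    beta_reduce
    congr 2
    · ring
    · ring

lemma lapl_iterate_coord_mul_lapl {k : ℕ} (hw : SmoothHS (2 * k + 2) w) :
    EqOn (lapl^[k] (fun x => x 0 * lapl w x - 2 * k * pd 0 w x))
      (fun x => x 0 * lapl^[k + 1] w x) (halfSpace N) := by
  induction k generalizing w with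
  | zero => intro x _; simp
  | succ k ih =>
    have hl : SmoothHS (2 * k + 2) (lapl w) := SmoothHS.lapl hw
    intro x hx
    rw [Function.iterate_succ_apply, Function.iterate_succ_apply, ← ih hl hx]
    refine lapl_iterate_congr ?_ k hx
    intro y hy
    have h1 : SmoothHS 2 (fun x => x 0 * lapl w x) := SmoothHS.coord.mul (hl.mono (by omega))
    have h2 : SmoothHS 2 (pd 0 w) := SmoothHS.pd (hw.mono (by omega)) 0
    have e : (fun x => x 0 * lapl w x - 2 * ((k + 1 : ℕ) : ℝ) * pd 0 w x)
        = fun x => 1 * (x 0 * lapl w x) + (-2 * ((k + 1 : ℕ) : ℝ)) * pd 0 w x := by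
      funext z; ring
    rw [e, lapl_lin h1 h2 1 _ hy]
    beta_reduce
    rw [lapl_coord_mul (hl.mono (by omega)) hy,
      ← pd_lapl (hw.mono (by omega)) 0 hy]
    push_cast
    ring

/-- The factorization of the weighted polyharmonic operator `x₀^{2m} Δ^m` into `m` second
order operators. -/
theorem partialProd_eq_lapl_iterate {m : ℕ} (hw : SmoothHS (2 * m) w) :
    EqOn (partialProd m w m) (fun x => x 0 ^ (2 * m) * lapl^[m] w x) (halfSpace N) := by
  induction m generalizing w with
  | zero => intro x _; simp [partialProd]
  | succ m ih =>
    set v : EuclideanSpace ℝ (Fin N) → ℝ := fun x => x 0 * lapl w x - 2 * m * pd 0 w x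
    have hv : SmoothHS (2 * m) v :=
      (SmoothHS.coord.mul (SmoothHS.lapl hw)).sub
        ((SmoothHS.const _).mul (SmoothHS.pd (k := 2 * m) (hw.mono (by omega)) 0))
    intro x hx
    simp only [partialProd]
    rw [← partialProd_opA hw _ _ hx]
    have e : opA (2 * ((m + 1 : ℕ) : ℝ) - 2)
        ((((m + 1 : ℕ) : ℝ) - (m + 1)) * (((m + 1 : ℕ) : ℝ) + m)) w = fun x => x 0 * v x := by
      funext y
      simp only [opA, v]
      push_cast
      ring
    rw [e]
    push_cast
    rw [partialProd_coord_mul hv _ hx]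
    beta_reduce
    rw [ih hv hx]
    beta_reduce
    rw [lapl_iterate_coord_mul_lapl hw hx]
    ring

end Factorization

/-- The closed half-space `{x | 0 ≤ x 0}`. -/
def closedHalfSpace (N : ℕ) [NeZero N] : Set (EuclideanSpace ℝ (Fin N)) := {x | 0 ≤ x 0}

/-- Iterated partial derivatives within the closed half-space, along a list of coordinates. -/
noncomputable def pdWord {N : ℕ} [NeZero N] (u : EuclideanSpace ℝ (Fin N) → ℝ) :
    List (Fin N) → EuclideanSpace ℝ (Fin N) → ℝ
  | [] => u
  | i :: l => fun x =>
      fderivWithin ℝ (pdWord u l) (closedHalfSpace N) x (EuclideanSpace.single i 1)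

section Boundary

variable {N : ℕ} [NeZero N] {u : EuclideanSpace ℝ (Fin N) → ℝ} {K : ℕ}

lemma halfSpace_subset_interior : halfSpace N ⊆ interior (closedHalfSpace N) :=
  interior_maximal (fun x (hx : 0 < x 0) => hx.le) isOpen_halfSpace

lemma halfSpace_subset_closed : halfSpace N ⊆ closedHalfSpace N :=
  fun x (hx : 0 < x 0) => hx.le

lemma closedHalfSpace_mem_nhds {x : EuclideanSpace ℝ (Fin N)} (hx : x ∈ halfSpace N) :
    closedHalfSpace N ∈ 𝓝 x := mem_interior_iff_mem_nhds.1 (halfSpace_subset_interior hx)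

lemma halfSpace_nonempty : (halfSpace N).Nonempty :=
  ⟨EuclideanSpace.single 0 1, by simp [halfSpace]⟩

lemma convex_closedHalfSpace : Convex ℝ (closedHalfSpace N) := by
  intro x hx y hy a b ha hb _
  simp only [closedHalfSpace, mem_ofPred_eq, PiLp.add_apply, PiLp.smul_apply, smul_eq_mul] at *
  positivity

lemma convex_halfSpace : Convex ℝ (halfSpace N) := by
  intro x hx y hy a b ha hb hab
  simp only [halfSpace, mem_ofPred_eq, PiLp.add_apply, PiLp.smul_apply, smul_eq_mul] at *
  rcases ha.eq_or_lt with rfl | ha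
  · have : b = 1 := by linarith
    simpa [this] using hy
  · positivity

lemma interior_closedHalfSpace_nonempty : (interior (closedHalfSpace N)).Nonempty :=
  halfSpace_nonempty.mono halfSpace_subset_interior

lemma uniqueDiffOn_closedHalfSpace : UniqueDiffOn ℝ (closedHalfSpace N) :=
  uniqueDiffOn_convex convex_closedHalfSpace interior_closedHalfSpace_nonempty

lemma mem_closure_interior {x : EuclideanSpace ℝ (Fin N)} (hx : x ∈ closedHalfSpace N) :
    x ∈ closure (interior (closedHalfSpace N)) := by
  rw [convex_closedHalfSpace.closure_interior_eq_closure_of_nonempty_interior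
    interior_closedHalfSpace_nonempty]
  exact subset_closure hx

lemma pdWord_contDiffOn (hu : ContDiffOn ℝ K u (closedHalfSpace N)) {k : ℕ} {l : List (Fin N)}
    (hk : k + l.length ≤ K) : ContDiffOn ℝ k (pdWord u l) (closedHalfSpace N) := by
  induction l generalizing k with
  | nil => exact hu.of_le (by exact_mod_cast hk)
  | cons i l ih =>
    have h1 : ContDiffOn ℝ (k + 1 : ℕ) (pdWord u l) (closedHalfSpace N) :=
      ih (by simp only [List.length_cons] at hk; omega)
    exact (h1.fderivWithin uniqueDiffOn_closedHalfSpace (by norm_cast)).clm_apply contDiffOn_const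

lemma pdWord_differentiableOn (hu : ContDiffOn ℝ K u (closedHalfSpace N)) {l : List (Fin N)}
    (hk : l.length < K) : DifferentiableOn ℝ (pdWord u l) (closedHalfSpace N) :=
  (pdWord_contDiffOn hu (k := 1) (by omega)).differentiableOn (by norm_num)

lemma pdWord_eq (hu : ContDiffOn ℝ K u (closedHalfSpace N)) {l : List (Fin N)}
    (hl : l.length ≤ K) : EqOn (pdWord u l) (fun x => iteratedFDerivWithin ℝ l.length u
      (closedHalfSpace N) x (fun k => EuclideanSpace.single (l.get k) 1)) (closedHalfSpace N) := by
  induction l with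
  | nil => intro x _; simp [pdWord]
  | cons i l ih =>
    intro x hx
    have hl' : l.length < K := by simpa using hl
    have hd := hu.differentiableOn_iteratedFDerivWithin (m := l.length) (by exact_mod_cast hl')
      uniqueDiffOn_closedHalfSpace x hx
    simp only [pdWord, List.length_cons]
    rw [iteratedFDerivWithin_succ_apply_left, fderivWithin_congr (ih hl'.le) (ih hl'.le hx),
      fderivWithin_continuousMultilinear_apply_const_apply (uniqueDiffOn_closedHalfSpace x hx) hd]
    rfl

lemma pdWord_perm (hu : ContDiffOn ℝ K u (closedHalfSpace N)) {l l' : List (Fin N)}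
    (h : l.Perm l') (hl : l.length ≤ K) :
    EqOn (pdWord u l) (pdWord u l') (closedHalfSpace N) := by
  induction h with
  | nil => exact fun _ _ => rfl
  | cons i _ ih =>
    intro x hx
    have ih := ih (by simp only [List.length_cons] at hl; omega)
    simp only [pdWord]
    rw [fderivWithin_congr ih (ih hx)]
  | swap i j l =>
    intro x hx
    have h1 : ContDiffOn ℝ 2 (pdWord u l) (closedHalfSpace N) :=
      pdWord_contDiffOn hu (k := 2) (by simp only [List.length_cons] at hl; omega)
    have hs : IsSymmSndFDerivWithinAt ℝ (pdWord u l) (closedHalfSpace N) x :=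
      (h1 x hx).isSymmSndFDerivWithinAt (by simp) uniqueDiffOn_closedHalfSpace
        (mem_closure_interior hx) hx
    have hd : DifferentiableWithinAt ℝ (fderivWithin ℝ (pdWord u l) (closedHalfSpace N))
        (closedHalfSpace N) x :=
      (h1.fderivWithin uniqueDiffOn_closedHalfSpace (m := 1) (by norm_num)).differentiableOn
        (by norm_num) x hx
    have e : ∀ v v' : EuclideanSpace ℝ (Fin N),
        fderivWithin ℝ (fun y => fderivWithin ℝ (pdWord u l) (closedHalfSpace N) y v)
          (closedHalfSpace N) x v'
        = fderivWithin ℝ (fderivWithin ℝ (pdWord u l) (closedHalfSpace N))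
          (closedHalfSpace N) x v' v := by
      intro v v'
      rw [fderivWithin_clm_apply (uniqueDiffOn_closedHalfSpace x hx) hd
        (differentiableWithinAt_const v)]
      simp
    simp only [pdWord]
    rw [e, e]
    exact hs.eq _ _
  | trans h1 _ ih1 ih2 =>
    exact (ih1 hl).trans (ih2 (by rw [← h1.length_eq]; exact hl))

lemma pdWord_bounded (hu : ContDiffOn ℝ K u (closedHalfSpace N))
    (hb : ∀ j : ℕ, j ≤ K → ∃ C : ℝ, ∀ x ∈ closedHalfSpace N,
      ‖iteratedFDerivWithin ℝ j u (closedHalfSpace N) x‖ ≤ C)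
    {l : List (Fin N)} (hl : l.length ≤ K) :
    ∃ C : ℝ, 0 ≤ C ∧ ∀ x ∈ closedHalfSpace N, |pdWord u l x| ≤ C := by
  obtain ⟨C, hC⟩ := hb _ hl
  refine ⟨max C 0, le_max_right _ _, fun x hx => ?_⟩
  rw [pdWord_eq hu hl hx, ← Real.norm_eq_abs]
  refine (ContinuousMultilinearMap.le_opNorm _ _).trans ?_
  simpa using Or.inl (hC x hx)

lemma pdWord_boundary (hu : ContDiffOn ℝ K u (closedHalfSpace N)) {m : ℕ} (hm : m ≤ K)
    (h0 : ∀ j : ℕ, j < m → ∀ x : EuclideanSpace ℝ (Fin N), x 0 = 0 →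
      iteratedFDerivWithin ℝ j u (closedHalfSpace N) x
        (fun _ => EuclideanSpace.single 0 1) = 0)
    (l : List (Fin N)) (hl : l.length < m) {x : EuclideanSpace ℝ (Fin N)} (hx : x 0 = 0) :
    pdWord u l x = 0 := by
  induction hn : l.length generalizing l x with
  | zero =>
    have := h0 0 (by omega) x hx
    obtain rfl : l = [] := List.length_eq_zero_iff.1 hn
    simpa [pdWord] using this
  | succ n ih =>
    have hxc : x ∈ closedHalfSpace N := hx.ge
    by_cases hall : ∀ i ∈ l, i = 0
    · rw [pdWord_eq hu (by omega) hxc]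
      have := h0 l.length hl x hx
      convert this using 3 with k
      rw [hall _ (l.get_mem k)]
    · push Not at hall
      obtain ⟨i, hil, hi⟩ := hall
      rw [pdWord_perm hu (List.perm_cons_erase hil) (by omega) hxc]
      have hlen : (l.erase i).length = n := by rw [List.length_erase_of_mem hil]; omega
      have hz : ∀ y : EuclideanSpace ℝ (Fin N), y 0 = 0 → pdWord u (l.erase i) y = 0 :=
        fun y hy => ih (l.erase i) (by omega) hy hlen
      have hd := (pdWord_differentiableOn hu (l := l.erase i) (by omega) x hxc).hasFDerivWithinAt
      set v : EuclideanSpace ℝ (Fin N) := EuclideanSpace.single i 1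
      have hline0 : ∀ t : ℝ, (x + t • v) 0 = 0 := fun t => by
        simp [v, hx, hi]
      have hline : HasDerivAt (fun t : ℝ => x + t • v) v 0 := by
        simpa using ((hasDerivAt_id (0 : ℝ)).smul_const v).const_add x
      have hc : HasDerivWithinAt (pdWord u (l.erase i) ∘ fun t : ℝ => x + t • v)
          (fderivWithin ℝ (pdWord u (l.erase i)) (closedHalfSpace N) x v) univ 0 := by
        refine HasFDerivWithinAt.comp_hasDerivWithinAt (t := closedHalfSpace N) 0 ?_
          hline.hasDerivWithinAt (fun t _ => (hline0 t).ge)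
        simpa using hd
      have hc' : HasDerivAt (fun _ : ℝ => (0 : ℝ))
          (fderivWithin ℝ (pdWord u (l.erase i)) (closedHalfSpace N) x v) 0 := by
        rw [hasDerivWithinAt_univ] at hc
        refine hc.congr_of_eventuallyEq (Eventually.of_forall fun t => ?_)
        exact (hz _ (hline0 t)).symm
      exact hc'.unique (hasDerivAt_const _ _)

lemma pdWord_cons_eq_pd (i : Fin N) (l : List (Fin N)) :
    EqOn (pdWord u (i :: l)) (pd i (pdWord u l)) (halfSpace N) := fun x hx => by
  simp only [pdWord, pd, fderivWithin_of_mem_nhds (closedHalfSpace_mem_nhds hx)]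

/-- Near the boundary, a derivative of order `m - k` decays at least like `x₀ ^ k`. -/
lemma pdWord_decay (hu : ContDiffOn ℝ K u (closedHalfSpace N)) {m : ℕ} (hm : m ≤ K)
    (hb : ∀ j : ℕ, j ≤ K → ∃ C : ℝ, ∀ x ∈ closedHalfSpace N,
      ‖iteratedFDerivWithin ℝ j u (closedHalfSpace N) x‖ ≤ C)
    (h0 : ∀ j : ℕ, j < m → ∀ x : EuclideanSpace ℝ (Fin N), x 0 = 0 →
      iteratedFDerivWithin ℝ j u (closedHalfSpace N) x
        (fun _ => EuclideanSpace.single 0 1) = 0)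
    (k : ℕ) (l : List (Fin N)) (hl : l.length + k = m) :
    ∃ C : ℝ, 0 ≤ C ∧ ∀ x ∈ closedHalfSpace N, |pdWord u l x| ≤ C * x 0 ^ k := by
  induction k generalizing l with
  | zero =>
    obtain ⟨C, hC, h⟩ := pdWord_bounded hu hb (l := l) (by omega)
    exact ⟨C, hC, fun x hx => by simpa using h x hx⟩
  | succ k ih =>
    obtain ⟨C, hC, h⟩ := ih (0 :: l) (by simp only [List.length_cons]; omega)
    refine ⟨C, hC, fun x hx => ?_⟩
    set v : EuclideanSpace ℝ (Fin N) := EuclideanSpace.single 0 1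
    set z : EuclideanSpace ℝ (Fin N) := x - x 0 • v
    have hz : z 0 = 0 := by simp [z, v]
    have hx' : 0 ≤ x 0 := hx
    have hcoord : ∀ t : ℝ, (z + t • v) 0 = t := fun t => by
      rw [PiLp.add_apply, hz]; simp [v]
    have hline : ∀ t : ℝ, HasDerivAt (fun t : ℝ => z + t • v) v t := fun t => by
      simpa using ((hasDerivAt_id t).smul_const v).const_add z
    have hmaps : MapsTo (fun t : ℝ => z + t • v) (Icc 0 (x 0)) (closedHalfSpace N) :=
      fun t ht => by
        change 0 ≤ (z + t • v) 0
        rw [hcoord]; exact ht.1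
    have hder : ∀ t ∈ Icc 0 (x 0), HasDerivWithinAt (fun t : ℝ => pdWord u l (z + t • v))
        (pdWord u (0 :: l) (z + t • v)) (Icc 0 (x 0)) t := by
      intro t ht
      have hd := (pdWord_differentiableOn hu (l := l) (by omega) _
        (hmaps ht)).hasFDerivWithinAt
      exact HasFDerivWithinAt.comp_hasDerivWithinAt t hd (hline t).hasDerivWithinAt hmaps
    have hbd : ∀ t ∈ Icc 0 (x 0), ‖pdWord u (0 :: l) (z + t • v)‖ ≤ C * x 0 ^ k := by
      intro t ht
      rw [Real.norm_eq_abs]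
      refine (h _ (hmaps ht)).trans ?_
      rw [hcoord]
      have := ht.1
      have := ht.2
      gcongr
    have := (convex_Icc (0 : ℝ) (x 0)).norm_image_sub_le_of_norm_hasDerivWithin_le hder hbd
      (left_mem_Icc.2 hx') (right_mem_Icc.2 hx')
    have hxz : z + x 0 • v = x := by simp [z]
    rw [hxz, zero_smul, add_zero, pdWord_boundary hu hm h0 l (by omega) hz, sub_zero, sub_zero,
      Real.norm_eq_abs, Real.norm_eq_abs, abs_of_nonneg hx'] at this
    calc _ ≤ _ := this
      _ = _ := by ring

end Boundary

/-- The weight `t ^ m` for `t ≤ 1` and `t ^ p` for `t > 1`. -/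
noncomputable def growthWeight (m p : ℕ) (t : ℝ) : ℝ := if t ≤ 1 then t ^ m else t ^ p

/-- `Growth m n p w`: all iterates of length `k ≤ n` of the fields `x₀ ∂ᵢ` applied to `w` are
`O(x₀ ^ m)` near the boundary and `O(x₀ ^ (p + k))` away from it. -/
def Growth {N : ℕ} [NeZero N] (m : ℕ) : ℕ → ℕ → (EuclideanSpace ℝ (Fin N) → ℝ) → Prop
  | 0, p, w => ∃ C : ℝ, ∀ x ∈ halfSpace N, |w x| ≤ C * growthWeight m p (x 0)
  | n + 1, p, w => SmoothHS 1 w ∧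
      (∃ C : ℝ, ∀ x ∈ halfSpace N, |w x| ≤ C * growthWeight m p (x 0)) ∧
      ∀ i, Growth m n (p + 1) (fun x => x 0 * pd i w x)

section Growth

variable {N : ℕ} [NeZero N] {m n p : ℕ} {f g w : EuclideanSpace ℝ (Fin N) → ℝ}

lemma growthWeight_nonneg {t : ℝ} (ht : 0 ≤ t) : 0 ≤ growthWeight m p t := by
  unfold growthWeight; split_ifs <;> positivity

lemma growthWeight_mono {q : ℕ} (hpq : p ≤ q) (t : ℝ) :
    growthWeight m p t ≤ growthWeight m q t := by
  unfold growthWeight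
  split_ifs with h
  · rfl
  · exact pow_le_pow_right₀ (not_le.1 h).le hpq

lemma bound_mono_weight {q : ℕ} (hpq : p ≤ q)
    (h : ∃ C : ℝ, ∀ x ∈ halfSpace N, |w x| ≤ C * growthWeight m p (x 0)) :
    ∃ C : ℝ, ∀ x ∈ halfSpace N, |w x| ≤ C * growthWeight m q (x 0) := by
  obtain ⟨C, hC⟩ := h
  refine ⟨max C 0, fun x hx => (hC x hx).trans ?_⟩
  have h1 := growthWeight_nonneg (m := m) (p := p) (le_of_lt (show 0 < x 0 from hx))
  have h2 := growthWeight_mono (m := m) hpq (x 0)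
  gcongr
  exact le_max_left _ _

lemma Growth.mono_weight {q : ℕ} (h : Growth m n p w) (hpq : p ≤ q) : Growth m n q w := by
  induction n generalizing p q w with
  | zero => exact bound_mono_weight hpq h
  | succ n ih => exact ⟨h.1, bound_mono_weight hpq h.2.1, fun i => ih (h.2.2 i) (by omega)⟩

lemma Growth.mono {k : ℕ} (h : Growth m n p w) (hk : k ≤ n) : Growth m k p w := by
  induction n generalizing p k w with
  | zero => obtain rfl : k = 0 := by omega
            exact h
  | succ n ih =>
    cases k with
    | zero => exact h.2.1
    | succ k => exact ⟨h.1, h.2.1, fun i => ih (h.2.2 i) (by omega)⟩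

lemma Growth.congr (h : Growth m n p f) (hfg : EqOn f g (halfSpace N)) : Growth m n p g := by
  induction n generalizing p f g with
  | zero =>
    obtain ⟨C, hC⟩ := h
    exact ⟨C, fun x hx => by rw [← hfg hx]; exact hC x hx⟩
  | succ n ih =>
    obtain ⟨hs, ⟨C, hC⟩, hd⟩ := h
    refine ⟨hs.congr hfg, ⟨C, fun x hx => by rw [← hfg hx]; exact hC x hx⟩, fun i => ?_⟩
    exact ih (hd i) fun x hx => by simp only [pd_congr hfg i hx]

lemma bound_lin (a b : ℝ)
    (hf : ∃ C : ℝ, ∀ x ∈ halfSpace N, |f x| ≤ C * growthWeight m p (x 0))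
    (hg : ∃ C : ℝ, ∀ x ∈ halfSpace N, |g x| ≤ C * growthWeight m p (x 0)) :
    ∃ C : ℝ, ∀ x ∈ halfSpace N, |a * f x + b * g x| ≤ C * growthWeight m p (x 0) := by
  obtain ⟨C, hC⟩ := hf
  obtain ⟨D, hD⟩ := hg
  refine ⟨|a| * C + |b| * D, fun x hx => ?_⟩
  calc |a * f x + b * g x| ≤ |a| * |f x| + |b| * |g x| := by
        rw [← abs_mul, ← abs_mul]; exact abs_add_le _ _
    _ ≤ |a| * (C * growthWeight m p (x 0)) + |b| * (D * growthWeight m p (x 0)) := by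
        gcongr
        · exact hC x hx
        · exact hD x hx
    _ = _ := by ring

lemma Growth.lin (hf : Growth m n p f) (hg : Growth m n p g) (a b : ℝ) :
    Growth m n p (fun x => a * f x + b * g x) := by
  induction n generalizing p f g with
  | zero => exact bound_lin a b hf hg
  | succ n ih =>
    refine ⟨((SmoothHS.const a).mul hf.1).add ((SmoothHS.const b).mul hg.1),
      bound_lin a b hf.2.1 hg.2.1, fun i => ?_⟩
    refine (ih (hf.2.2 i) (hg.2.2 i)).congr fun x hx => ?_
    simp only [pd_lin hf.1 hg.1 a b i hx]
    ring

lemma growth_zero : Growth m n p (fun _ : EuclideanSpace ℝ (Fin N) => (0 : ℝ)) := by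
  induction n generalizing p with
  | zero => exact ⟨0, fun x _ => by simp⟩
  | succ n ih =>
    refine ⟨SmoothHS.const 0, ⟨0, fun x _ => by simp⟩, fun i => ?_⟩
    refine ih.congr fun x _ => ?_
    simp [pd]

lemma Growth.sum {ι : Type*} (s : Finset ι) {F : ι → EuclideanSpace ℝ (Fin N) → ℝ}
    (hF : ∀ i, Growth m n p (F i)) : Growth m n p (fun x => ∑ i ∈ s, F i x) := by
  classical
  induction s using Finset.induction_on with
  | empty => simpa using growth_zero
  | insert i s hi ih =>
    refine ((hF i).lin ih 1 1).congr fun x _ => ?_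
    simp [Finset.sum_insert hi]

lemma Growth.opA (h : Growth m (n + 2) p w) (hw : SmoothHS 2 w) (c d : ℝ) :
    Growth m n (p + 2) (opA c d w) := by
  have hsum := Growth.sum Finset.univ fun i => (h.2.2 i).2.2 i
  have h1 : Growth m n (p + 2) (fun x => x 0 * pd 0 w x) :=
    ((h.2.2 0).mono (by omega)).mono_weight (by omega)
  have h2 : Growth m n (p + 2) w := (h.mono (by omega)).mono_weight (by omega)
  refine (hsum.lin (h1.lin h2 (-(1 + c)) d) 1 1).congr fun x hx => ?_
  have key : ∀ i : Fin N, x 0 * pd i (fun x => x 0 * pd i w x) x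
      = x 0 ^ 2 * pd i (pd i w) x + if i = 0 then x 0 * pd 0 w x else 0 := by
    intro i
    rw [pd_coord_mul (SmoothHS.pd hw i) i hx]
    by_cases hi : i = 0
    · subst hi; simp; ring
    · simp [hi]; ring
  simp only [key, _root_.opA, lapl, Finset.sum_add_distrib, ← Finset.mul_sum]
  simp
  ring

lemma Growth.partialProd {k : ℕ} (h : Growth m (n + 2 * k) p w) (hw : SmoothHS (2 * k) w)
    (M : ℝ) : Growth m n (p + 2 * k) (partialProd M w k) := by
  induction k generalizing n with
  | zero => exact h
  | succ k ih =>
    have h1 := ih (n := n + 2) (h.mono (by omega)) (hw.mono (by omega))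
    exact h1.opA (SmoothHS.partialProd (hw.mono (by omega)) M) _ _

lemma coord_mul_pd_pow_mul (hw : SmoothHS 1 w) (k : ℕ) (i : Fin N) :
    EqOn (fun x => x 0 * pd i (fun x => x 0 ^ k * w x) x)
      (fun x => (if i = 0 then (k : ℝ) else 0) * (x 0 ^ k * w x) + x 0 ^ (k + 1) * pd i w x)
      (halfSpace N) := by
  have hs : ∀ k : ℕ, SmoothHS 1 (fun x : EuclideanSpace ℝ (Fin N) => x 0 ^ k * w x) := by
    intro k
    induction k with
    | zero => simpa using hw
    | succ k ih =>
      refine (SmoothHS.coord.mul ih).congr fun x _ => ?_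
      simp only; ring
  induction k with
  | zero => intro x _; simp
  | succ k ih =>
    intro x hx
    have e : (fun x : EuclideanSpace ℝ (Fin N) => x 0 ^ (k + 1) * w x)
        = fun x => x 0 * (x 0 ^ k * w x) := by funext y; ring
    have := ih hx
    simp only at this ⊢
    rw [e, pd_coord_mul (hs k) i hx]
    simp only [mul_add, this]
    push_cast
    split_ifs <;> ring

lemma growth_pdWord {K : ℕ} {u : EuclideanSpace ℝ (Fin N) → ℝ}
    (hu : ContDiffOn ℝ K u (closedHalfSpace N)) (hm : m ≤ K)
    (hb : ∀ j : ℕ, j ≤ K → ∃ C : ℝ, ∀ x ∈ closedHalfSpace N,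
      ‖iteratedFDerivWithin ℝ j u (closedHalfSpace N) x‖ ≤ C)
    (h0 : ∀ j : ℕ, j < m → ∀ x : EuclideanSpace ℝ (Fin N), x 0 = 0 →
      iteratedFDerivWithin ℝ j u (closedHalfSpace N) x
        (fun _ => EuclideanSpace.single 0 1) = 0)
    (n : ℕ) (l : List (Fin N)) (hl : l.length + n < K) :
    Growth m n l.length (fun x => x 0 ^ l.length * pdWord u l x) := by
  have hbound : ∀ l : List (Fin N), l.length < K → ∃ C : ℝ, ∀ x ∈ halfSpace N,
      |x 0 ^ l.length * pdWord u l x| ≤ C * growthWeight m l.length (x 0) := by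
    intro l hl
    obtain ⟨C, hC0, hC⟩ := pdWord_bounded hu hb hl.le
    have hdec : ∃ D : ℝ, 0 ≤ D ∧ ∀ x ∈ halfSpace N, x 0 ≤ 1 →
        x 0 ^ l.length * |pdWord u l x| ≤ D * x 0 ^ m := by
      by_cases hlm : l.length ≤ m
      · obtain ⟨D, hD0, hD⟩ := pdWord_decay hu hm hb h0 (m - l.length) l (by omega)
        refine ⟨D, hD0, fun x hx _ => ?_⟩
        have hx0 : 0 < x 0 := hx
        calc x 0 ^ l.length * |pdWord u l x|
            ≤ x 0 ^ l.length * (D * x 0 ^ (m - l.length)) := by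
              gcongr; exact hD x (halfSpace_subset_closed hx)
          _ = D * (x 0 ^ l.length * x 0 ^ (m - l.length)) := by ring
          _ = D * x 0 ^ m := by rw [← pow_add, Nat.add_sub_cancel' hlm]
      · refine ⟨C, hC0, fun x hx hx1 => ?_⟩
        have hx0 : 0 < x 0 := hx
        rw [mul_comm]
        have h1 := hC x (halfSpace_subset_closed hx)
        have h2 : x 0 ^ l.length ≤ x 0 ^ m := pow_le_pow_of_le_one hx0.le hx1 (by omega)
        gcongr
    obtain ⟨D, hD0, hD⟩ := hdec
    refine ⟨C + D, fun x hx => ?_⟩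
    have hx0 : 0 < x 0 := hx
    rw [abs_mul, abs_of_nonneg (pow_nonneg hx0.le _)]
    unfold growthWeight
    split_ifs with hx1
    · refine (hD x hx hx1).trans ?_
      gcongr
      linarith
    · rw [mul_comm]
      have := hC x (halfSpace_subset_closed hx)
      gcongr
      linarith
  induction n generalizing l with
  | zero => exact hbound l hl
  | succ n ih =>
    have hs : SmoothHS 1 (pdWord u l) :=
      (pdWord_contDiffOn hu (k := 1) (by omega)).mono halfSpace_subset_closed
    have hp : SmoothHS 1 (fun x : EuclideanSpace ℝ (Fin N) => x 0 ^ l.length) := by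
      have : ContDiff ℝ (1 : ℕ) (fun x : EuclideanSpace ℝ (Fin N) => x 0 ^ l.length) := by
        fun_prop
      exact this.contDiffOn
    refine ⟨hp.mul hs, hbound l (by omega), fun i => ?_⟩
    have h1 : Growth m n (l.length + 1) (fun x => x 0 ^ l.length * pdWord u l x) :=
      (ih l (by omega)).mono_weight (by omega)
    have h2 : Growth m n (l.length + 1)
        (fun x => x 0 ^ (l.length + 1) * pdWord u (i :: l) x) :=
      ih (i :: l) (by simp only [List.length_cons]; omega)
    refine (h1.lin h2 (if i = 0 then (l.length : ℝ) else 0) 1).congr fun x hx => ?_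
    have := coord_mul_pd_pow_mul hs l.length i hx
    simp only at this ⊢
    rw [this, pdWord_cons_eq_pd i l hx, one_mul]

end Growth

section MaximumPrinciple

variable {N : ℕ} [NeZero N] {w : EuclideanSpace ℝ (Fin N) → ℝ}

omit [NeZero N] in
lemma hasFDerivAt_comp_dist_sq {φ : ℝ → ℝ} {φ' : ℝ} (z x : EuclideanSpace ℝ (Fin N))
    (h : HasDerivAt φ φ' (‖x - z‖ ^ 2)) :
    HasFDerivAt (fun y => φ (‖y - z‖ ^ 2)) (φ' • (2 • innerSL ℝ (x - z))) x := by
  have h1 : HasFDerivAt (fun y : EuclideanSpace ℝ (Fin N) => ‖y - z‖ ^ 2)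
      (2 • innerSL ℝ (x - z)) x := by
    have := ((hasFDerivAt_id x).sub_const z).norm_sq
    simpa using this
  exact h.comp_hasFDerivAt x h1

omit [NeZero N] in
lemma pd_comp_dist_sq {φ φ' : ℝ → ℝ} (z : EuclideanSpace ℝ (Fin N))
    (h : ∀ s, 0 ≤ s → HasDerivAt φ (φ' s) s) (i : Fin N) :
    pd i (fun y => φ (‖y - z‖ ^ 2)) = fun x => φ' (‖x - z‖ ^ 2) * (2 * (x i - z i)) := by
  funext x
  unfold pd
  rw [(hasFDerivAt_comp_dist_sq z x (h _ (by positivity))).fderiv]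
  simp [EuclideanSpace.inner_single_right]

omit [NeZero N] in
lemma lapl_comp_dist_sq {φ φ' φ'' : ℝ → ℝ} (z : EuclideanSpace ℝ (Fin N))
    (h : ∀ s, 0 ≤ s → HasDerivAt φ (φ' s) s) (h' : ∀ s, 0 ≤ s → HasDerivAt φ' (φ'' s) s)
    (x : EuclideanSpace ℝ (Fin N)) :
    lapl (fun y => φ (‖y - z‖ ^ 2)) x
      = 4 * ‖x - z‖ ^ 2 * φ'' (‖x - z‖ ^ 2) + 2 * N * φ' (‖x - z‖ ^ 2) := by
  have key : ∀ i : Fin N, pd i (pd i (fun y => φ (‖y - z‖ ^ 2))) x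
      = 4 * φ'' (‖x - z‖ ^ 2) * (x i - z i) ^ 2 + 2 * φ' (‖x - z‖ ^ 2) := by
    intro i
    rw [pd_comp_dist_sq z h i]
    have h1 := hasFDerivAt_comp_dist_sq z x (h' _ (by positivity))
    have h2 : HasFDerivAt (fun y : EuclideanSpace ℝ (Fin N) => 2 * (y i - z i))
        ((2 : ℝ) • (EuclideanSpace.proj i : EuclideanSpace ℝ (Fin N) →L[ℝ] ℝ)) x :=
      ((EuclideanSpace.proj i : EuclideanSpace ℝ (Fin N) →L[ℝ] ℝ).hasFDerivAt.sub_const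
        (z i)).const_mul 2
    unfold pd
    rw [(h1.fun_mul h2).fderiv]
    simp [EuclideanSpace.inner_single_right]
    ring
  simp only [lapl, key, Finset.sum_add_distrib, ← Finset.mul_sum]
  rw [EuclideanSpace.norm_sq_eq]
  simp
  ring

omit [NeZero N] in
lemma pd_eq_zero_of_isLocalMin {p : EuclideanSpace ℝ (Fin N)} (hmin : IsLocalMin w p)
    (i : Fin N) : pd i w p = 0 := by
  simp [pd, hmin.fderiv_eq_zero]

lemma lapl_nonneg_of_isLocalMin (hw : SmoothHS 2 w) {p : EuclideanSpace ℝ (Fin N)}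
    (hp : p ∈ halfSpace N) (hmin : IsLocalMin w p) : 0 ≤ lapl w p := by
  refine Finset.sum_nonneg fun i _ => ?_
  set v : EuclideanSpace ℝ (Fin N) := EuclideanSpace.single i 1
  have hline : ∀ s : ℝ, HasDerivAt (fun t : ℝ => p + t • v) v s := fun s => by
    simpa using ((hasDerivAt_id s).smul_const v).const_add p
  have hp0 : p + (0 : ℝ) • v = p := by simp
  have hp0' : p + (0 : ℝ) • v ∈ halfSpace N := by rwa [hp0]
  have hcont : ContinuousAt (fun t : ℝ => p + t • v) 0 := (hline 0).continuousAt
  have hmem : ∀ᶠ s : ℝ in 𝓝 0, p + s • v ∈ halfSpace N :=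
    hcont.eventually_mem (isOpen_halfSpace.mem_nhds hp0')
  set φ : ℝ → ℝ := fun t => w (p + t • v)
  have h1 : deriv φ =ᶠ[𝓝 0] fun t => pd i w (p + t • v) := by
    filter_upwards [hmem] with s hs
    exact ((hw.differentiableAt hs).hasFDerivAt.comp_hasDerivAt s (hline s)).deriv
  have h2 : deriv (deriv φ) 0 = pd i (pd i w) p := by
    rw [h1.deriv_eq]
    have := (((SmoothHS.pd hw i).differentiableAt hp0').hasFDerivAt.comp_hasDerivAt 0
      (hline 0)).deriv
    rw [hp0] at this
    exact this
  have h3 : deriv φ 0 = 0 := by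
    rw [h1.self_of_nhds]
    beta_reduce
    rw [hp0, pd_eq_zero_of_isLocalMin hmin]
  have hφc : ContinuousAt φ 0 :=
    ((hw.differentiableAt hp0').hasFDerivAt.comp_hasDerivAt 0 (hline 0)).continuousAt
  have hφmin : IsLocalMin φ 0 := by
    have : Tendsto (fun t : ℝ => p + t • v) (𝓝 0) (𝓝 p) := by
      have := hcont.tendsto
      rwa [hp0] at this
    have h := this.eventually hmin
    filter_upwards [h] with t ht
    simpa [φ] using ht
  by_contra! hneg
  have hφmax : IsLocalMax φ 0 :=
    isLocalMax_of_deriv_deriv_neg (by rw [h2]; exact hneg) h3 hφc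
  have hconst : φ =ᶠ[𝓝 0] fun _ => φ 0 := by
    filter_upwards [hφmin, hφmax] with t h h' using le_antisymm h' h
  have : deriv (deriv φ) 0 = 0 := by
    rw [hconst.deriv.deriv_eq]; simp
  rw [h2] at this
  linarith

lemma opA_nonneg_of_isLocalMin (hw : SmoothHS 2 w) {p : EuclideanSpace ℝ (Fin N)}
    (hp : p ∈ halfSpace N) (hmin : IsLocalMin w p) {c d : ℝ} (hd : 0 ≤ d * w p) :
    0 ≤ opA c d w p := by
  have h1 := lapl_nonneg_of_isLocalMin hw hp hmin
  simp only [opA, pd_eq_zero_of_isLocalMin hmin]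
  have := mul_nonneg (sq_nonneg (p 0)) h1
  linarith

lemma opA_pow_mul (hw : SmoothHS 2 w) (a : ℕ) (c d : ℝ) :
    EqOn (opA c d (fun x => x 0 ^ a * w x))
      (fun x => x 0 ^ a * opA (c - 2 * a) (d - a * c + a * (a - 1)) w x) (halfSpace N) := by
  induction a generalizing c d with
  | zero => intro x _; simp
  | succ a ih =>
    intro x hx
    have hs : SmoothHS 2 (fun x : EuclideanSpace ℝ (Fin N) => x 0 ^ a * w x) := by
      have : ContDiff ℝ (2 : ℕ) (fun x : EuclideanSpace ℝ (Fin N) => x 0 ^ a) := by fun_prop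
      exact SmoothHS.mul this.contDiffOn hw
    have e : (fun x : EuclideanSpace ℝ (Fin N) => x 0 ^ (a + 1) * w x)
        = fun x => x 0 * (x 0 ^ a * w x) := by funext y; ring
    rw [e, opA_coord_mul hs c d hx]
    beta_reduce
    rw [ih _ _ hx]
    beta_reduce
    have e1 : c - 2 - 2 * a = c - 2 * ((a + 1 : ℕ) : ℝ) := by push_cast; ring
    have e2 : d - c - a * (c - 2) + a * (a - 1)
        = d - ((a + 1 : ℕ) : ℝ) * c + ((a + 1 : ℕ) : ℝ) * (((a + 1 : ℕ) : ℝ) - 1) := by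
      push_cast; ring
    rw [e1, e2]
    ring

/-- The slowly growing factor `log (1 + |x|²) + N + 3` of the comparison function. -/
noncomputable def logBarrier (N : ℕ) (x : EuclideanSpace ℝ (Fin N)) : ℝ :=
  Real.log (1 + ‖x - 0‖ ^ 2) + (N + 3)

omit [NeZero N] in
lemma le_logBarrier (x : EuclideanSpace ℝ (Fin N)) : (N + 3 : ℝ) ≤ logBarrier N x := by
  have : 0 ≤ Real.log (1 + ‖x - 0‖ ^ 2) := Real.log_nonneg (by nlinarith [sq_nonneg ‖x - 0‖])
  unfold logBarrier
  linarith

lemma smoothHS_logBarrier : SmoothHS 2 (logBarrier N) := by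
  have : ContDiff ℝ (2 : ℕ) (logBarrier N) := by
    unfold logBarrier
    refine ContDiff.add (ContDiff.log ?_ fun x => by positivity) contDiff_const
    exact contDiff_const.add ((contDiff_id.sub contDiff_const).norm_sq ℝ)
  exact this.contDiffOn

lemma opA_logBarrier_neg {k : ℕ} (hk : 1 ≤ k) {b e : ℝ} (hb0 : 0 ≤ b) (hb : b ≤ 2 * k)
    (he : 2 * k ≤ e) {x : EuclideanSpace ℝ (Fin N)} (hx : x ∈ halfSpace N) :
    opA (-b) (-e) (logBarrier N) x < 0 := by
  have hφ : ∀ s : ℝ, 0 ≤ s →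
      HasDerivAt (fun s => Real.log (1 + s) + (N + 3)) (1 / (1 + s)) s := by
    intro s hs
    simpa using (((hasDerivAt_id s).const_add 1).log (by simp; positivity)).add_const (N + 3 : ℝ)
  have hφ' : ∀ s : ℝ, 0 ≤ s →
      HasDerivAt (fun s : ℝ => 1 / (1 + s)) (-1 / (1 + s) ^ 2) s := by
    intro s hs
    have := ((hasDerivAt_id s).const_add 1).fun_inv (by simp; positivity)
    simpa using this
  have hL := lapl_comp_dist_sq 0 hφ hφ' x
  have hD := congrFun (pd_comp_dist_sq (0 : EuclideanSpace ℝ (Fin N)) hφ 0) x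
  have hg := le_logBarrier x
  have hx0 : 0 < x 0 := hx
  change lapl (logBarrier N) x = _ at hL
  change pd 0 (logBarrier N) x = _ at hD
  have hxn : x 0 ^ 2 ≤ ‖x - 0‖ ^ 2 := by
    rw [sub_zero, EuclideanSpace.norm_sq_eq]
    refine le_trans (by simp) (Finset.single_le_sum (f := fun i => ‖x i‖ ^ 2)
      (fun i _ => by positivity) (Finset.mem_univ 0))
  set s := ‖x - 0‖ ^ 2
  have hs : 0 ≤ s := by positivity
  have hq : x 0 ^ 2 * (1 / (1 + s)) ≤ 1 := by
    rw [mul_one_div, div_le_one (by positivity)]; linarith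
  have hq0 : 0 ≤ x 0 ^ 2 * (1 / (1 + s)) := by positivity
  have hneg : x 0 ^ 2 * (4 * s * (-1 / (1 + s) ^ 2)) ≤ 0 := by
    have : 0 ≤ x 0 ^ 2 * (4 * s * (1 / (1 + s) ^ 2)) := by positivity
    have e : x 0 ^ 2 * (4 * s * (-1 / (1 + s) ^ 2)) = -(x 0 ^ 2 * (4 * s * (1 / (1 + s) ^ 2))) := by
      ring
    linarith
  have hk' : (1 : ℝ) ≤ k := by exact_mod_cast hk
  have hN : (0 : ℝ) ≤ N := by positivity
  simp only [opA, hL, hD]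
  set q := x 0 ^ 2 * (1 / (1 + s)) with hqdef
  set g := logBarrier N x
  have e1 : x 0 ^ 2 * (4 * s * (-1 / (1 + s) ^ 2) + 2 * N * (1 / (1 + s)))
      - -b * x 0 * (1 / (1 + s) * (2 * (x 0 - (0 : EuclideanSpace ℝ (Fin N)) 0))) + -e * g
      = x 0 ^ 2 * (4 * s * (-1 / (1 + s) ^ 2)) + 2 * N * q + 2 * b * q - e * g := by
    simp only [hqdef, PiLp.zero_apply]; ring
  rw [e1]
  have h1 : 2 * N * q ≤ 2 * N := by nlinarith
  have h2 : 2 * b * q ≤ 4 * k := by nlinarith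
  have h3 : 2 * k * (N + 3) ≤ e * g :=
    mul_le_mul he hg (by positivity) (by linarith)
  nlinarith

/-- Comparison principle for the operators `A_j`, `2 ≤ j ≤ m`, where `j = k + 1`. -/
theorem nonneg_of_opA_nonpos {m k : ℕ} (hk : 1 ≤ k) (hkm : k + 1 ≤ m) (hw : SmoothHS 2 w)
    (hgr : Growth m 0 (2 * k) w)
    (hA : ∀ x ∈ halfSpace N, opA (2 * m - 2) (((m : ℝ) - (k + 1)) * (m + k)) w x ≤ 0) :
    ∀ x ∈ halfSpace N, 0 ≤ w x := by
  obtain ⟨a, rfl⟩ : ∃ a, m = a + 1 := ⟨m - 1, by omega⟩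
  set c : ℝ := 2 * ((a + 1 : ℕ) : ℝ) - 2 with hc
  set d : ℝ := (((a + 1 : ℕ) : ℝ) - (k + 1)) * (((a + 1 : ℕ) : ℝ) + k) with hd
  set g := logBarrier N
  set h : EuclideanSpace ℝ (Fin N) → ℝ := fun x => 1 * (x 0 ^ a * g x) + 1 * (x 0 ^ (a + k) * g x)
    with hh
  have hps : ∀ b : ℕ, SmoothHS 2 (fun x : EuclideanSpace ℝ (Fin N) => x 0 ^ b * g x) := by
    intro b
    have : ContDiff ℝ (2 : ℕ) (fun x : EuclideanSpace ℝ (Fin N) => x 0 ^ b) := by fun_prop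
    exact SmoothHS.mul this.contDiffOn smoothHS_logBarrier
  have hhs : SmoothHS 2 h :=
    ((SmoothHS.const 1).mul (hps a)).add ((SmoothHS.const 1).mul (hps (a + k)))
  have hk' : (1 : ℝ) ≤ k := by exact_mod_cast hk
  have hhA : ∀ x ∈ halfSpace N, opA c d h x < 0 := by
    intro x hx
    have hx0 : 0 < x 0 := hx
    rw [opA_lin (hps a) (hps (a + k)) 1 1 c d hx]
    beta_reduce
    rw [opA_pow_mul smoothHS_logBarrier a c d hx,
      opA_pow_mul smoothHS_logBarrier (a + k) c d hx]
    beta_reduce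
    have e1 : c - 2 * a = -0 := by rw [hc]; push_cast; ring
    have e2 : d - a * c + a * (a - 1) = -(k * (k + 1) : ℝ) := by
      rw [hd, hc]; push_cast; ring
    have e3 : c - 2 * ((a + k : ℕ) : ℝ) = -(2 * k : ℝ) := by rw [hc]; push_cast; ring
    have e4 : d - ((a + k : ℕ) : ℝ) * c + ((a + k : ℕ) : ℝ) * (((a + k : ℕ) : ℝ) - 1)
        = -(2 * k : ℝ) := by
      rw [hd, hc]; push_cast; ring
    rw [e1, e2, e3, e4]
    have h1 := opA_logBarrier_neg hk (b := 0) (e := k * (k + 1)) le_rfl (by positivity)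
      (by nlinarith) hx
    have h2 := opA_logBarrier_neg hk (b := 2 * k) (e := 2 * k) (by positivity) le_rfl le_rfl hx
    have p1 : 0 < x 0 ^ a := by positivity
    have p2 : 0 < x 0 ^ (a + k) := by positivity
    nlinarith [mul_neg_of_pos_of_neg p1 h1, mul_neg_of_pos_of_neg p2 h2]
  have hg3 : ∀ x : EuclideanSpace ℝ (Fin N), 3 ≤ g x := fun x => by
    have := le_logBarrier x
    have : (0 : ℝ) ≤ N := by positivity
    linarith
  have hhpos : ∀ x ∈ halfSpace N, 0 < h x := by
    intro x hx
    have hx0 : 0 < x 0 := hx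
    have := hg3 x
    have : 0 < g x := by linarith
    simp only [hh]; positivity
  by_contra! hcon
  obtain ⟨x₀, hx₀, hneg⟩ := hcon
  obtain ⟨C', hC'⟩ := hgr
  set C := max C' 1
  have hCpos : 0 < C := lt_max_of_lt_right one_pos
  have hC : ∀ x ∈ halfSpace N, |w x| ≤ C * growthWeight (a + 1) (2 * k) (x 0) := fun x hx =>
    (hC' x hx).trans (mul_le_mul_of_nonneg_right (le_max_left _ _)
      (growthWeight_nonneg (le_of_lt hx)))
  set δ := -(w x₀ / h x₀) with hδ
  have hδpos : 0 < δ := by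
    rw [hδ, neg_pos]; exact div_neg_of_neg_of_pos hneg (hhpos x₀ hx₀)
  set T : Set (EuclideanSpace ℝ (Fin N)) :=
    {x | min 1 (δ / C) ≤ x 0} ∩ Metric.closedBall 0 (Real.exp (C / δ)) with hT
  have hη : 0 < min 1 (δ / C) := lt_min one_pos (by positivity)
  have hTH : T ⊆ halfSpace N := fun x hx => hη.trans_le hx.1
  have hTc : IsCompact T := by
    refine (isCompact_closedBall 0 _).inter_left ?_
    exact isClosed_le continuous_const (by fun_prop)
  have hST : ∀ x ∈ halfSpace N, w x / h x ≤ -δ → x ∈ T := by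
    intro x hx hle
    have hx0 : 0 < x 0 := hx
    have hgx := hg3 x
    have hgpos : 0 < g x := by linarith
    have h1 : δ * h x ≤ C * growthWeight (a + 1) (2 * k) (x 0) := by
      rw [div_le_iff₀ (hhpos x hx)] at hle
      have := (neg_le_abs (w x)).trans (hC x hx)
      linarith
    have hp1 : 0 < x 0 ^ a := by positivity
    have hp2 : 0 < x 0 ^ (a + k) := by positivity
    have hA1 : x 0 ^ a * g x ≤ h x := by
      simp only [hh, one_mul]
      have : 0 < x 0 ^ (a + k) * g x := by positivity
      linarith
    have hA2 : x 0 ^ (a + k) * g x ≤ h x := by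
      simp only [hh, one_mul]
      have : 0 < x 0 ^ a * g x := by positivity
      linarith
    have hboth : (min 1 (δ / C) ≤ x 0) ∧ δ * g x ≤ C := by
      unfold growthWeight at h1
      split_ifs at h1 with hx1
      · have h2 : δ * g x * x 0 ^ a ≤ C * x 0 * x 0 ^ a := by
          calc δ * g x * x 0 ^ a = δ * (x 0 ^ a * g x) := by ring
            _ ≤ δ * h x := by gcongr
            _ ≤ C * x 0 ^ (a + 1) := h1
            _ = C * x 0 * x 0 ^ a := by ring
        have h3 := le_of_mul_le_mul_right h2 hp1
        refine ⟨min_le_of_right_le ?_, h3.trans (by nlinarith)⟩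
        rw [div_le_iff₀ hCpos]
        nlinarith
      · push Not at hx1
        refine ⟨min_le_of_left_le hx1.le, ?_⟩
        have h2 : δ * g x * x 0 ^ (a + k) ≤ C * x 0 ^ (a + k) := by
          calc δ * g x * x 0 ^ (a + k) = δ * (x 0 ^ (a + k) * g x) := by ring
            _ ≤ δ * h x := by gcongr
            _ ≤ C * x 0 ^ (2 * k) := h1
            _ ≤ C * x 0 ^ (a + k) := by
              gcongr
              · exact hx1.le
              · omega
        exact le_of_mul_le_mul_right h2 hp2
    refine ⟨hboth.1, ?_⟩
    have h4 : Real.log (1 + ‖x - 0‖ ^ 2) ≤ C / δ := by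
      rw [le_div_iff₀ hδpos]
      have e : g x = Real.log (1 + ‖x - 0‖ ^ 2) + (N + 3) := rfl
      have h5 := hboth.2
      rw [e] at h5
      nlinarith [(by positivity : (0 : ℝ) ≤ δ * (N + 3))]
    rw [Real.log_le_iff_le_exp (by positivity), sub_zero] at h4
    rw [mem_closedBall_zero_iff]
    nlinarith [sq_nonneg (‖x‖ - 1)]
  have hx₀T : x₀ ∈ T := hST x₀ hx₀ (by rw [hδ, neg_neg])
  have hFc : ContinuousOn (fun x => w x / h x) T := by
    refine ContinuousOn.div (ContDiffOn.continuousOn hw |>.mono hTH)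
      (ContDiffOn.continuousOn hhs |>.mono hTH) fun x hx => (hhpos x (hTH hx)).ne'
  obtain ⟨p, hpT, hpmin⟩ := hTc.exists_isMinOn ⟨x₀, hx₀T⟩ hFc
  have hpH := hTH hpT
  have hple : w p / h p ≤ -δ := by rw [hδ, neg_neg]; exact hpmin hx₀T
  have hpall : ∀ x ∈ halfSpace N, w p / h p ≤ w x / h x := by
    intro x hx
    by_cases hxT : x ∈ T
    · exact hpmin hxT
    · exact hple.trans (le_of_lt (not_le.1 fun hle => hxT (hST x hx hle)))
  set e : ℝ := -(w p / h p) with he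
  have hepos : 0 < e := by linarith
  set G : EuclideanSpace ℝ (Fin N) → ℝ := fun x => 1 * w x + e * h x with hG
  have hGs : SmoothHS 2 G := ((SmoothHS.const 1).mul hw).add ((SmoothHS.const e).mul hhs)
  have hGp : G p = 0 := by
    have := (hhpos p hpH).ne'
    simp only [hG, he]; field_simp; ring
  have hGmin : IsLocalMin G p := by
    filter_upwards [isOpen_halfSpace.mem_nhds hpH] with x hx
    rw [hGp]
    have h1 := hpall x hx
    rw [le_div_iff₀ (hhpos x hx)] at h1
    simp only [hG, he]
    linarith
  have h1 := opA_nonneg_of_isLocalMin hGs hpH hGmin (c := c) (d := d) (by rw [hGp]; simp)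
  rw [opA_lin hw hhs 1 e c d hpH] at h1
  have h2 := hA p hpH
  have h3 := hhA p hpH
  beta_reduce at h1
  nlinarith

end MaximumPrinciple

section StrongMaximumPrinciple

variable {N : ℕ} [NeZero N] {w : EuclideanSpace ℝ (Fin N) → ℝ}

/-- Positivity of a nonnegative supersolution spreads from a ball to a larger concentric ball. -/
lemma pos_on_ball (hw : SmoothHS 2 w) (hnn : ∀ x ∈ halfSpace N, 0 ≤ w x) {b : ℝ} (hb : 0 ≤ b)
    (hA : ∀ x ∈ halfSpace N, opA b 0 w x ≤ 0) {z : EuclideanSpace ℝ (Fin N)} {r R : ℝ}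
    (hr : 0 < r) (hrR : r < R) (hR : Metric.closedBall z R ⊆ halfSpace N)
    (hpos : ∀ x ∈ Metric.closedBall z r, 0 < w x) : ∀ x ∈ Metric.ball z R, 0 < w x := by
  have hR0 : 0 < R := hr.trans hrR
  have hwc : ContinuousOn w (Metric.closedBall z R) :=
    (ContDiffOn.continuousOn hw).mono hR
  have hsub : Metric.closedBall z r ⊆ Metric.closedBall z R :=
    Metric.closedBall_subset_closedBall hrR.le
  obtain ⟨y₁, hy₁, hy₁min⟩ := (isCompact_closedBall z R).exists_isMinOn
    ⟨z, Metric.mem_closedBall_self hR0.le⟩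
    (f := fun x : EuclideanSpace ℝ (Fin N) => x 0) (by fun_prop)
  obtain ⟨y₂, hy₂, hy₂min⟩ := (isCompact_closedBall z r).exists_isMinOn
    ⟨z, Metric.mem_closedBall_self hr.le⟩ (hwc.mono hsub)
  set τ := y₁ 0
  have hτ : 0 < τ := hR hy₁
  set μ := w y₂
  have hμ : 0 < μ := hpos y₂ hy₂
  set α : ℝ := (N + (b * R + 1) / τ) / (2 * r ^ 2) with hα
  have hαpos : 0 < α := by positivity
  have hα' : 2 * α * r ^ 2 = N + (b * R + 1) / τ := by rw [hα]; field_simp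
  set E : EuclideanSpace ℝ (Fin N) → ℝ := fun x => Real.exp (-α * ‖x - z‖ ^ 2) with hE
  have hEs : SmoothHS 2 E := by
    have : ContDiff ℝ (2 : ℕ) E :=
      (contDiff_const.mul ((contDiff_id.sub contDiff_const).norm_sq ℝ)).exp
    exact this.contDiffOn
  have hφ : ∀ s : ℝ, 0 ≤ s →
      HasDerivAt (fun s => Real.exp (-α * s)) (-α * Real.exp (-α * s)) s := by
    intro s _
    have := ((hasDerivAt_id s).const_mul (-α)).exp
    simpa [mul_comm] using this
  have hφ' : ∀ s : ℝ, 0 ≤ s →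
      HasDerivAt (fun s => -α * Real.exp (-α * s)) (-α * (-α * Real.exp (-α * s))) s :=
    fun s hs => (hφ s hs).const_mul (-α)
  have hEA : ∀ x ∈ Metric.closedBall z R, r < ‖x - z‖ → 0 < opA b 0 E x := by
    intro x hx hxr
    have hx0 : 0 < x 0 := hR hx
    have hL := lapl_comp_dist_sq z hφ hφ' x
    have hD := congrFun (pd_comp_dist_sq z hφ 0) x
    change lapl E x = _ at hL
    change pd 0 E x = _ at hD
    simp only [opA, hL, hD]
    have hexp := Real.exp_pos (-α * ‖x - z‖ ^ 2)
    set e := Real.exp (-α * ‖x - z‖ ^ 2)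
    have hτx : τ ≤ x 0 := hy₁min hx
    have hdist : -R ≤ x 0 - z 0 := by
      have h1 : |x 0 - z 0| ≤ ‖x - z‖ := by
        have := PiLp.norm_apply_le (x - z) 0
        simpa using this
      have h2 : ‖x - z‖ ≤ R := by rwa [← mem_closedBall_iff_norm]
      have := neg_le_of_abs_le (h1.trans h2)
      linarith
    have hsq : r ^ 2 ≤ ‖x - z‖ ^ 2 := by gcongr
    have h3 : (b * R + 1) / τ ≤ 2 * α * ‖x - z‖ ^ 2 - N := by nlinarith
    have h4 : b * R + 1 ≤ x 0 * (2 * α * ‖x - z‖ ^ 2 - N) := by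
      calc b * R + 1 = τ * ((b * R + 1) / τ) := by field_simp
        _ ≤ _ := by gcongr
    have h5 : 0 < x 0 * (2 * α * ‖x - z‖ ^ 2 - N) + b * (x 0 - z 0) := by nlinarith
    have h6 : 0 < 2 * α * e * x 0 * (x 0 * (2 * α * ‖x - z‖ ^ 2 - N) + b * (x 0 - z 0)) := by
      positivity
    calc 0 < _ := h6
      _ = _ := by ring
  set κ := Real.exp (-α * R ^ 2) with hκ
  have hκpos : 0 < κ := Real.exp_pos _
  set v : EuclideanSpace ℝ (Fin N) → ℝ := fun x => 1 * w x + -μ * (1 * E x + -κ * 1) with hv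
  have hinner : SmoothHS 2 (fun x => 1 * E x + -κ * 1) :=
    ((SmoothHS.const 1).mul hEs).add (SmoothHS.const _)
  have hvs : SmoothHS 2 v :=
    ((SmoothHS.const 1).mul hw).add ((SmoothHS.const _).mul hinner)
  obtain ⟨p, hp, hpmin⟩ := (isCompact_closedBall z R).exists_isMinOn
    ⟨z, Metric.mem_closedBall_self hR0.le⟩ ((ContDiffOn.continuousOn hvs).mono hR)
  have hvp : 0 ≤ v p := by
    by_contra! hneg
    have hpr : r < ‖p - z‖ := by
      by_contra! hle
      have h1 : μ ≤ w p := hy₂min (by rwa [mem_closedBall_iff_norm])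
      have h2 : E p ≤ 1 := Real.exp_le_one_iff.2 (by nlinarith [sq_nonneg ‖p - z‖])
      simp only [hv] at hneg
      nlinarith
    have hpR : ‖p - z‖ < R := by
      refine lt_of_le_of_ne (by rwa [← mem_closedBall_iff_norm]) fun heq => ?_
      have h1 := hnn p (hR hp)
      have h2 : E p = κ := by simp only [hE, hκ, heq]
      simp only [hv, h2] at hneg
      linarith
    have hloc : IsLocalMin v p := by
      filter_upwards [Metric.isOpen_ball.mem_nhds (mem_ball_iff_norm.2 hpR)] with x hx
      exact hpmin (Metric.ball_subset_closedBall hx)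
    have h1 := opA_nonneg_of_isLocalMin hvs (hR hp) hloc (c := b) (d := 0) (by simp)
    rw [opA_lin hw hinner 1 (-μ) b 0 (hR hp)] at h1
    beta_reduce at h1
    rw [opA_lin hEs (SmoothHS.const 1) 1 (-κ) b 0 (hR hp)] at h1
    have h2 : opA b 0 (fun _ : EuclideanSpace ℝ (Fin N) => (1 : ℝ)) p = 0 := by
      have e : ∀ (i : Fin N) (a : ℝ),
          pd i (fun _ : EuclideanSpace ℝ (Fin N) => a) = fun _ => 0 := by
        intro i a; funext y; simp [pd]
      simp [opA, lapl, e]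
    beta_reduce at h1
    rw [h2] at h1
    have h3 := hA p (hR hp)
    have h4 := mul_pos hμ (hEA p hp hpr)
    linarith
  intro x hx
  have h1 : v p ≤ v x := hpmin (Metric.ball_subset_closedBall hx)
  have h2 : κ < E x := by
    refine Real.exp_lt_exp.2 ?_
    have : ‖x - z‖ ^ 2 < R ^ 2 := by
      have := mem_ball_iff_norm.1 hx
      gcongr
    nlinarith
  have h3 : 0 ≤ v x := hvp.trans h1
  simp only [hv] at h3
  nlinarith [mul_pos hμ (sub_pos.2 h2)]

/-- Strong maximum principle for nonnegative supersolutions of `x₀² Δ - b x₀ ∂₀`. -/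
theorem pos_of_opA_nonpos (hw : SmoothHS 2 w) (hnn : ∀ x ∈ halfSpace N, 0 ≤ w x) {b : ℝ}
    (hb : 0 ≤ b) (hA : ∀ x ∈ halfSpace N, opA b 0 w x ≤ 0)
    (hne : ∃ x ∈ halfSpace N, 0 < w x) : ∀ x ∈ halfSpace N, 0 < w x := by
  set S : Set (EuclideanSpace ℝ (Fin N)) := halfSpace N ∩ w ⁻¹' Ioi 0
  have hSo : IsOpen S :=
    (ContDiffOn.continuousOn hw).isOpen_inter_preimage isOpen_halfSpace isOpen_Ioi
  obtain ⟨x₁, hx₁, hwx₁⟩ := hne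
  have hsub : halfSpace N ⊆ S := by
    refine convex_halfSpace.isPreconnected.subset_of_closure_inter_subset hSo
      ⟨x₁, hx₁, hx₁, hwx₁⟩ ?_
    rintro p ⟨hpc, hpH⟩
    refine ⟨hpH, ?_⟩
    obtain ⟨ε, hε, hball⟩ := Metric.isOpen_iff.1 isOpen_halfSpace p hpH
    obtain ⟨z, hzS, hz⟩ := Metric.mem_closure_iff.1 hpc (ε / 4) (by positivity)
    obtain ⟨r, hr, hrS⟩ := Metric.isOpen_iff.1 hSo z hzS
    have hbig : Metric.closedBall z (ε / 2) ⊆ halfSpace N := by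
      refine subset_trans (fun x hx => ?_) hball
      rw [Metric.mem_closedBall] at hx
      rw [Metric.mem_ball]
      have := dist_triangle x z p
      rw [dist_comm] at hz
      linarith
    refine pos_on_ball hw hnn hb hA (z := z) (r := min (r / 2) (ε / 4)) (R := ε / 2)
      (by positivity) ((min_le_right _ _).trans_lt (by linarith)) hbig (fun x hx => ?_) p ?_
    · refine (hrS ?_).2
      rw [Metric.mem_closedBall] at hx
      rw [Metric.mem_ball]
      have := min_le_left (r / 2) (ε / 4)
      linarith
    · rw [Metric.mem_ball]
      linarith
  exact fun x hx => (hsub hx).2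

end StrongMaximumPrinciple

section Positivity

variable {N : ℕ} [NeZero N] {w : EuclideanSpace ℝ (Fin N) → ℝ}

/-- If the last partial product has the sign `(-1) ^ m`, the `k`-th one has the sign `(-1) ^ k`. -/
lemma partialProd_sign {m : ℕ} (hw : SmoothHS (2 * m) w) (hgr : Growth m (2 * m - 2) 0 w)
    (hlast : ∀ x ∈ halfSpace N, 0 ≤ (-1 : ℝ) ^ m * partialProd m w m x) {k : ℕ} (hk : 1 ≤ k)
    (hkm : k ≤ m) : ∀ x ∈ halfSpace N, 0 ≤ (-1 : ℝ) ^ k * partialProd m w k x := by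
  induction hkm using Nat.decreasingInduction with
  | self => exact hlast
  | of_succ k hkm ih =>
    have ih := ih (by omega)
    have hs : SmoothHS 2 (partialProd m w k) := SmoothHS.partialProd (hw.mono (by omega)) m
    have hg : Growth m 0 (2 * k) (partialProd m w k) := by
      have := Growth.partialProd (n := 0) (k := k) (hgr.mono (by omega)) (hw.mono (by omega))
        (m : ℝ)
      simpa using this
    have e : EqOn (fun x => (-1 : ℝ) ^ k * partialProd m w k x + 0 * partialProd m w k x)
        (fun x => (-1 : ℝ) ^ k * partialProd m w k x) (halfSpace N) := fun x _ => by
      simp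
    have hs' : SmoothHS 2 (fun x => (-1 : ℝ) ^ k * partialProd m w k x + 0 * partialProd m w k x) :=
      ((SmoothHS.const _).mul hs).add ((SmoothHS.const _).mul hs)
    have key := nonneg_of_opA_nonpos hk hkm hs' (hg.lin hg _ _) fun x hx => by
      rw [opA_lin hs hs _ _ _ _ hx]
      have := ih x hx
      rw [partialProd, pow_succ] at this
      simp only [zero_mul, add_zero]
      linarith
    intro x hx
    exact (key x hx).trans_eq (e hx)

end Positivity

end

/-- Strong positivity: a nonnegative bounded classical solution of the half-space
Dirichlet problem `(-Δ)^m u = u^q` (with `q > 1`) which is not identically zero is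
strictly positive in the open half-space. -/
theorem stmt_19 {N m : ℕ} [NeZero N] (hm : 0 < m) (q : ℝ) (hq : 1 < q)
    (u : EuclideanSpace ℝ (Fin N) → ℝ)
    (hsol : IsBCSol N m q u)
    (hpos : ∀ x : EuclideanSpace ℝ (Fin N), 0 ≤ x 0 → 0 ≤ u x)
    (hne : ∃ x : EuclideanSpace ℝ (Fin N), 0 ≤ x 0 ∧ u x ≠ 0) :
    ∀ x : EuclideanSpace ℝ (Fin N), 0 < x 0 → 0 < u x := by
  obtain ⟨hC, hCb, hbd, heq, hdir⟩ := hsol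
  have hs : SmoothHS (2 * m) u := hC
  have hgr : Growth m (2 * m - 2) 0 u := by
    have := growth_pdWord (K := 2 * m - 1) (m := m) (u := u) hCb (by omega) hbd hdir
      (2 * m - 2) [] (by simp; omega)
    exact this.congr fun x _ => by simp [pdWord]
  have hlast : ∀ x ∈ halfSpace N, 0 ≤ (-1 : ℝ) ^ m * partialProd m u m x := by
    intro x hx
    have h1 := heq x hx
    rw [polyLap, lap_iterate_eq hs hx] at h1
    rw [partialProd_eq_lapl_iterate hs hx]
    have h2 : 0 ≤ u x ^ q := Real.rpow_nonneg (hpos x (le_of_lt hx)) q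
    have h3 : 0 ≤ x 0 ^ (2 * m) := pow_nonneg (le_of_lt hx) _
    calc 0 ≤ x 0 ^ (2 * m) * u x ^ q := mul_nonneg h3 h2
      _ = _ := by rw [← h1]; ring
  have hfirst := partialProd_sign hs hgr hlast le_rfl hm
  have hm1 : (1 : ℝ) ≤ m := by exact_mod_cast hm
  refine pos_of_opA_nonpos (hs.mono (by omega)) (fun x hx => hpos x (le_of_lt hx))
    (b := 2 * (m : ℝ) - 2) (by linarith) (fun x hx => ?_) ?_
  · have h1 := hfirst x hx
    simp only [partialProd, opA, pow_one, Nat.cast_zero, zero_add, add_zero] at h1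
    simp only [opA]
    have h2 : 0 ≤ ((m : ℝ) - 1) * m * u x :=
      mul_nonneg (mul_nonneg (by linarith) (by linarith)) (hpos x (le_of_lt hx))
    linarith
  · obtain ⟨x, hx, hux⟩ := hne
    rcases hx.eq_or_lt with h0 | h0
    · have := hdir 0 hm x h0.symm
      simp at this
      exact absurd this hux
    · exact ⟨x, h0, lt_of_le_of_ne (hpos x hx) hux.symm⟩
end
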